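/- If A and B are homologically smooth DG algebras over a field k, then A ⊗_k B is homologically smooth; in particular, if A is homologically smooth then so are A^op and A^e = A^op ⊗ A. -/

import Mathlib

/- Framework: differential graded algebras (internal ℤ-grading), right DG modules,
DG bimodules, homotopy-theoretic notions (twisted modules, perfectness,
homological smoothness), cohomology and Hochschild homology. -/

open DirectSum TensorProduct

noncomputable section
set_option linter.unusedVariables false

/-- `(-1)^i` for `i : ℤ`, valued in `ℤ`. -/
def sgnz (i : ℤ) : ℤ := if Even i then 1 else -1

/-- `(-1)^i` for `i : ℤ`, valued in a field `k`. -/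
def sgnk (k : Type) [Field k] (i : ℤ) : k := if Even i then 1 else -1

/-- A differential graded algebra over a field `k`: a `k`-algebra with an internal
ℤ-grading and a square-zero degree `+1` differential satisfying the graded Leibniz rule. -/
structure DGAlgebra (k : Type) [Field k] : Type 1 where
  R : Type
  [ring : Ring R]
  [alg : Algebra k R]
  gr : ℤ → Submodule k R
  [dec : DirectSum.Decomposition gr]
  one_mem : (1 : R) ∈ gr 0
  mul_mem : ∀ {i j : ℤ} {x y : R}, x ∈ gr i → y ∈ gr j → x * y ∈ gr (i + j)
  d : R →ₗ[k] R
  d_deg : ∀ (i : ℤ), ∀ x ∈ gr i, d x ∈ gr (i + 1)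
  d_sq : ∀ x : R, d (d x) = 0
  leibniz : ∀ (i : ℤ), ∀ x ∈ gr i, ∀ y : R,
    d (x * y) = d x * y + sgnz i • (x * d y)

attribute [instance] DGAlgebra.ring DGAlgebra.alg DGAlgebra.dec

variable {k : Type} [Field k]

/-- A right DG module over a DG algebra `A`.  The right action of `x : A` on `m`
is written `act x m` (representing `m · x`). -/
structure DGMod (A : DGAlgebra k) : Type 1 where
  M : Type
  [acg : AddCommGroup M]
  [kmod : Module k M]
  gm : ℤ → Submodule k M
  [dec : DirectSum.Decomposition gm]
  act : A.R →ₗ[k] M →ₗ[k] M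
  act_one : ∀ m : M, act 1 m = m
  act_mul : ∀ (x y : A.R) (m : M), act (x * y) m = act y (act x m)
  act_deg : ∀ (i j : ℤ) (x : A.R) (m : M), x ∈ A.gr i → m ∈ gm j → act x m ∈ gm (j + i)
  D : M →ₗ[k] M
  D_deg : ∀ (j : ℤ), ∀ m ∈ gm j, D m ∈ gm (j + 1)
  D_sq : ∀ m : M, D (D m) = 0
  leibniz : ∀ (i j : ℤ) (x : A.R) (m : M), x ∈ A.gr i → m ∈ gm j →
    D (act x m) = act x (D m) + sgnz j • act (A.d x) m

attribute [instance] DGMod.acg DGMod.kmod DGMod.dec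

variable {A : DGAlgebra k}

/-- Morphisms of right DG modules (closed, degree 0). -/
structure DGHom (X Y : DGMod A) where
  f : X.M →ₗ[k] Y.M
  deg : ∀ (j : ℤ), ∀ m ∈ X.gm j, f m ∈ Y.gm j
  actc : ∀ (x : A.R) (m : X.M), f (X.act x m) = Y.act x (f m)
  comm : ∀ m : X.M, f (X.D m) = Y.D (f m)

/-- The identity morphism. -/
def DGHom.id (X : DGMod A) : DGHom X X :=
  ⟨LinearMap.id, fun _ _ h => h, fun _ _ => rfl, fun _ => rfl⟩

/-- Composition of morphisms of DG modules. -/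
def DGHom.comp {X Y Z : DGMod A} (G : DGHom Y Z) (F : DGHom X Y) : DGHom X Z :=
  ⟨G.f ∘ₗ F.f, fun j m h => G.deg j _ (F.deg j m h),
    fun x m => by simp [LinearMap.comp_apply, F.actc, G.actc],
    fun m => by simp [LinearMap.comp_apply, F.comm, G.comm]⟩

/-- The zero morphism. -/
def DGHom.zero (X Y : DGMod A) : DGHom X Y :=
  ⟨0, fun j _ _ => (Y.gm j).zero_mem, fun _ _ => by simp, fun _ => by simp⟩

/-- Chain homotopy between two morphisms of DG modules. -/
def Homotopic {X Y : DGMod A} (F G : DGHom X Y) : Prop :=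
  ∃ h : X.M →ₗ[k] Y.M,
    (∀ (j : ℤ), ∀ m ∈ X.gm j, h m ∈ Y.gm (j - 1)) ∧
    (∀ (x : A.R) (m : X.M), h (X.act x m) = Y.act x (h m)) ∧
    ∀ m : X.M, F.f m - G.f m = Y.D (h m) + h (X.D m)

/-- Cycles of degree `n` of a complex given by a grading and a differential. -/
def Zg {M : Type} [AddCommGroup M] [Module k M]
    (gm : ℤ → Submodule k M) (Dm : M →ₗ[k] M) (n : ℤ) : Submodule k M :=
  gm n ⊓ LinearMap.ker Dm

/-- Boundaries of degree `n`. -/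
def Bg {M : Type} [AddCommGroup M] [Module k M]
    (gm : ℤ → Submodule k M) (Dm : M →ₗ[k] M) (n : ℤ) : Submodule k M :=
  gm n ⊓ LinearMap.range Dm

/-- Degree `n` cohomology of a complex. -/
def Hg {M : Type} [AddCommGroup M] [Module k M]
    (gm : ℤ → Submodule k M) (Dm : M →ₗ[k] M) (n : ℤ) : Type :=
  ↥(Zg gm Dm n) ⧸ (Submodule.comap (Zg gm Dm n).subtype (Bg gm Dm n))

instance {M : Type} [AddCommGroup M] [Module k M]
    (gm : ℤ → Submodule k M) (Dm : M →ₗ[k] M) (n : ℤ) : AddCommGroup (Hg gm Dm n) := by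
  unfold Hg; infer_instance

instance {M : Type} [AddCommGroup M] [Module k M]
    (gm : ℤ → Submodule k M) (Dm : M →ₗ[k] M) (n : ℤ) : Module k (Hg gm Dm n) := by
  unfold Hg; infer_instance

/-- `f` induces an isomorphism on the homology of two complexes presented by
(families of) cycle and boundary submodules. -/
def InducesHIso {M₁ M₂ : Type} [AddCommGroup M₁] [Module k M₁] [AddCommGroup M₂] [Module k M₂]
    (Z₁ B₁ : ℤ → Submodule k M₁) (Z₂ B₂ : ℤ → Submodule k M₂) (f : M₁ →ₗ[k] M₂) : Prop :=
  (∀ n : ℤ, ∀ x ∈ Z₁ n, f x ∈ Z₂ n) ∧ (∀ n : ℤ, ∀ x ∈ B₁ n, f x ∈ B₂ n) ∧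
  ∀ n : ℤ, (∀ z ∈ Z₂ n, ∃ w ∈ Z₁ n, f w - z ∈ B₂ n) ∧
    (∀ w ∈ Z₁ n, f w ∈ B₂ n → w ∈ B₁ n)

/-- Quasi-isomorphism of complexes, in elementary terms. -/
def QIsoData {M₁ M₂ : Type} [AddCommGroup M₁] [Module k M₁] [AddCommGroup M₂] [Module k M₂]
    (gm₁ : ℤ → Submodule k M₁) (D₁ : M₁ →ₗ[k] M₁)
    (gm₂ : ℤ → Submodule k M₂) (D₂ : M₂ →ₗ[k] M₂) (f : M₁ →ₗ[k] M₂) : Prop :=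
  InducesHIso (Zg gm₁ D₁) (Bg gm₁ D₁) (Zg gm₂ D₂) (Bg gm₂ D₂) f

/-- A morphism of DG modules is a quasi-isomorphism if it induces isomorphisms on
all cohomology groups. -/
def IsQuasiIso {X Y : DGMod A} (F : DGHom X Y) : Prop :=
  QIsoData X.gm X.D Y.gm Y.D F.f

/-- A DG module is acyclic if all its cohomology vanishes. -/
def AcyclicM (X : DGMod A) : Prop := ∀ n : ℤ, Zg X.gm X.D n ≤ Bg X.gm X.D n

/-- The `A`-submodule of a right DG module generated by a set. -/
def rSpan (X : DGMod A) (S : Set X.M) : Submodule k X.M :=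
  sInf {p : Submodule k X.M | S ⊆ ↑p ∧ ∀ (x : A.R) (m : X.M), m ∈ p → X.act x m ∈ p}

/-- Twisted modules: finitely generated semi-free right DG `A`-modules, i.e.
modules with a finite homogeneous basis `e` such that `D (e j)` lies in the
`A`-span of the previous basis elements ("strictly upper triangular" twisting). -/
def IsTwisted (T : DGMod A) : Prop :=
  ∃ (s : ℕ) (r : Fin s → ℤ) (e : Fin s → T.M),
    (∀ j, e j ∈ T.gm (-(r j))) ∧
    (∀ j, T.D (e j) ∈ rSpan T (e '' {i | i < j})) ∧
    Function.Bijective (fun v : Fin s → A.R => ∑ j, T.act (v j) (e j))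

/-- `P` is a homotopy direct summand of `T`. -/
def IsHoSummand (P T : DGMod A) : Prop :=
  ∃ (ι : DGHom P T) (ρ : DGHom T P), Homotopic (ρ.comp ι) (DGHom.id P)

/-- A perfect DG module: one admitting a resolution by a homotopy direct summand
of a twisted module. -/
def IsPerfect (N : DGMod A) : Prop :=
  ∃ T P : DGMod A, IsTwisted T ∧ IsHoSummand P T ∧ ∃ F : DGHom P N, IsQuasiIso F

/-- Homotopically projective (K-projective) DG modules. -/
def IsHoProjM (P : DGMod A) : Prop :=
  ∀ N : DGMod A, AcyclicM N → ∀ F : DGHom P N, Homotopic F (DGHom.zero P N)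

/-- Compactness of a DG algebra: the total cohomology is finite dimensional. -/
def IsCompactAlg (A : DGAlgebra k) : Prop :=
  (∀ n : ℤ, FiniteDimensional k (Hg A.gr A.d n)) ∧
    {n : ℤ | ¬ Subsingleton (Hg A.gr A.d n)}.Finite
/-- The grading operator on a graded module scaling the degree `j` component by `c j`. -/
def gop {M : Type} [AddCommGroup M] [Module k M]
    (gm : ℤ → Submodule k M) [DirectSum.Decomposition gm] (c : ℤ → k) : M →ₗ[k] M :=
  (DirectSum.toModule k ℤ M (fun j => c j • (gm j).subtype)) ∘ₗ
    (DirectSum.decomposeLinearEquiv gm).toLinearMap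

/-- A DG bimodule over `A` (equivalently, a right DG module over `Aᵉ = Aᵒᵖ ⊗ A`). -/
structure DGBimod (A : DGAlgebra k) : Type 1 where
  M : Type
  [acg : AddCommGroup M]
  [kmod : Module k M]
  gm : ℤ → Submodule k M
  [dec : DirectSum.Decomposition gm]
  actL : A.R →ₗ[k] M →ₗ[k] M
  actR : A.R →ₗ[k] M →ₗ[k] M
  actL_one : ∀ m : M, actL 1 m = m
  actR_one : ∀ m : M, actR 1 m = m
  actL_mul : ∀ (x y : A.R) (m : M), actL (x * y) m = actL x (actL y m)
  actR_mul : ∀ (x y : A.R) (m : M), actR (x * y) m = actR y (actR x m)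
  actLR : ∀ (x y : A.R) (m : M), actL x (actR y m) = actR y (actL x m)
  actL_deg : ∀ (i j : ℤ) (x : A.R) (m : M), x ∈ A.gr i → m ∈ gm j → actL x m ∈ gm (i + j)
  actR_deg : ∀ (i j : ℤ) (x : A.R) (m : M), x ∈ A.gr i → m ∈ gm j → actR x m ∈ gm (j + i)
  D : M →ₗ[k] M
  D_deg : ∀ (j : ℤ), ∀ m ∈ gm j, D m ∈ gm (j + 1)
  D_sq : ∀ m : M, D (D m) = 0
  leibnizL : ∀ (i j : ℤ) (x : A.R) (m : M), x ∈ A.gr i → m ∈ gm j →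
    D (actL x m) = actL (A.d x) m + sgnz i • actL x (D m)
  leibnizR : ∀ (i j : ℤ) (x : A.R) (m : M), x ∈ A.gr i → m ∈ gm j →
    D (actR x m) = actR x (D m) + sgnz j • actR (A.d x) m

attribute [instance] DGBimod.acg DGBimod.kmod DGBimod.dec

/-- Morphisms of DG bimodules (closed, degree 0). -/
structure BimodHom {A : DGAlgebra k} (X Y : DGBimod A) where
  f : X.M →ₗ[k] Y.M
  deg : ∀ (j : ℤ), ∀ m ∈ X.gm j, f m ∈ Y.gm j
  actLc : ∀ (x : A.R) (m : X.M), f (X.actL x m) = Y.actL x (f m)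
  actRc : ∀ (x : A.R) (m : X.M), f (X.actR x m) = Y.actR x (f m)
  comm : ∀ m : X.M, f (X.D m) = Y.D (f m)

def BimodHom.id (X : DGBimod A) : BimodHom X X :=
  ⟨LinearMap.id, fun _ _ h => h, fun _ _ => rfl, fun _ _ => rfl, fun _ => rfl⟩

def BimodHom.comp {X Y Z : DGBimod A} (G : BimodHom Y Z) (F : BimodHom X Y) : BimodHom X Z :=
  ⟨G.f ∘ₗ F.f, fun j m h => G.deg j _ (F.deg j m h),
    fun x m => by simp [LinearMap.comp_apply, F.actLc, G.actLc],
    fun x m => by simp [LinearMap.comp_apply, F.actRc, G.actRc],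
    fun m => by simp [LinearMap.comp_apply, F.comm, G.comm]⟩

def BimodHom.zero (X Y : DGBimod A) : BimodHom X Y :=
  ⟨0, fun j _ _ => (Y.gm j).zero_mem, fun _ _ => by simp, fun _ _ => by simp, fun _ => by simp⟩

/-- Chain homotopy between morphisms of DG bimodules (with the Koszul sign for the
left action). -/
def BimodHomotopic {X Y : DGBimod A} (F G : BimodHom X Y) : Prop :=
  ∃ h : X.M →ₗ[k] Y.M,
    (∀ (j : ℤ), ∀ m ∈ X.gm j, h m ∈ Y.gm (j - 1)) ∧
    (∀ (i : ℤ) (x : A.R), x ∈ A.gr i → ∀ m : X.M, h (X.actL x m) = sgnz i • Y.actL x (h m)) ∧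
    (∀ (x : A.R) (m : X.M), h (X.actR x m) = Y.actR x (h m)) ∧
    ∀ m : X.M, F.f m - G.f m = Y.D (h m) + h (X.D m)

def AcyclicB (X : DGBimod A) : Prop := ∀ n : ℤ, Zg X.gm X.D n ≤ Bg X.gm X.D n

def IsHoProjB (P : DGBimod A) : Prop :=
  ∀ N : DGBimod A, AcyclicB N → ∀ F : BimodHom P N, BimodHomotopic F (BimodHom.zero P N)

/-- Auxiliary: the action of a homogeneous element of degree `i` in the first tensor
factor of `Aᵉ` on a bimodule, with its Koszul sign. -/
def biactAux (N : DGBimod A) (i : ℤ) : ↥(A.gr i) →ₗ[k] A.R →ₗ[k] N.M →ₗ[k] N.M where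
  toFun x :=
    { toFun := fun y => (N.actL ↑x) ∘ₗ (N.actR y) ∘ₗ (gop N.gm fun j => sgnk k (i * j))
      map_add' := by intro y z; ext m; simp
      map_smul' := by intro c y; ext m; simp }
  map_add' := by intro x z; ext y m; simp [Submodule.coe_add]
  map_smul' := by intro c x; ext y m; simp

/-- The right action of `Aᵉ = Aᵒᵖ ⊗ A` (as a `k`-module, `A.R ⊗[k] A.R`) on a DG
bimodule, with Koszul signs. -/
def biact (N : DGBimod A) : (A.R ⊗[k] A.R) →ₗ[k] N.M →ₗ[k] N.M :=
  TensorProduct.lift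
    ((DirectSum.toModule k ℤ _ (fun i => biactAux N i)) ∘ₗ
      (DirectSum.decomposeLinearEquiv A.gr).toLinearMap)

/-- The sub-bimodule generated by a set. -/
def biSpan (N : DGBimod A) (S : Set N.M) : Submodule k N.M :=
  sInf {p : Submodule k N.M | S ⊆ ↑p ∧ (∀ (x : A.R) (m : N.M), m ∈ p → N.actL x m ∈ p) ∧
    ∀ (x : A.R) (m : N.M), m ∈ p → N.actR x m ∈ p}

/-- Twisted DG bimodules: finitely generated semi-free DG `Aᵉ`-modules. -/
def IsTwistedB (T : DGBimod A) : Prop :=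
  ∃ (s : ℕ) (r : Fin s → ℤ) (e : Fin s → T.M),
    (∀ j, e j ∈ T.gm (-(r j))) ∧
    (∀ j, T.D (e j) ∈ biSpan T (e '' {i | i < j})) ∧
    Function.Bijective (fun v : Fin s → A.R ⊗[k] A.R => ∑ j, biact T (v j) (e j))

def IsHoSummandB (P T : DGBimod A) : Prop :=
  ∃ (ι : BimodHom P T) (ρ : BimodHom T P), BimodHomotopic (ρ.comp ι) (BimodHom.id P)

def IsPerfectB (N : DGBimod A) : Prop :=
  ∃ T P : DGBimod A, IsTwistedB T ∧ IsHoSummandB P T ∧ ∃ F : BimodHom P N, QIsoData P.gm P.D N.gm N.D F.f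

/-- The diagonal bimodule: `A` as a DG bimodule over itself. -/
def diagBimod (A : DGAlgebra k) : DGBimod A where
  M := A.R
  gm := A.gr
  actL := LinearMap.mul k A.R
  actR := (LinearMap.mul k A.R).flip
  actL_one := fun m => one_mul m
  actR_one := fun m => mul_one m
  actL_mul := fun x y m => mul_assoc x y m
  actR_mul := fun x y m => (mul_assoc m x y).symm
  actLR := fun x y m => (mul_assoc x m y).symm
  actL_deg := fun i j x m hx hm => A.mul_mem hx hm
  actR_deg := fun i j x m hx hm => A.mul_mem hm hx
  D := A.d
  D_deg := A.d_deg
  D_sq := A.d_sq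
  leibnizL := fun i j x m hx _ => A.leibniz i x hx m
  leibnizR := fun i j x m _ hm => A.leibniz j m hm x

/-- `A` is homologically smooth if the diagonal bimodule is perfect over `Aᵉ`. -/
def IsSmooth (A : DGAlgebra k) : Prop := IsPerfectB (diagBimod A)

/-- The graded commutator subspace `[A, P] ⊆ P` of a DG bimodule. -/
def commSub (P : DGBimod A) : Submodule k P.M :=
  Submodule.span k {z : P.M | ∃ (i j : ℤ) (x : A.R) (m : P.M), x ∈ A.gr i ∧ m ∈ P.gm j ∧
    z = P.actL x m - sgnz (i * j) • P.actR x m}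

/-- Degree-`n` cycles of the complex `P/[A,P]` (computing `P ⊗_{Aᵉ} A`), described by
representatives in `P`. -/
def HHZ (P : DGBimod A) (n : ℤ) : Submodule k P.M :=
  P.gm n ⊓ (commSub P).comap P.D

/-- Degree-`n` boundaries of the complex `P/[A,P]`, described by representatives. -/
def HHB (P : DGBimod A) (n : ℤ) : Submodule k P.M :=
  P.gm n ⊓ (commSub P ⊔ LinearMap.range P.D)

/-- The `n`-th Hochschild homology group `HH_n(A) = H^n(P ⊗_{Aᵉ} A)` computed from a
bimodule resolution `P` of the diagonal. -/
def HHspace (P : DGBimod A) (n : ℤ) : Type :=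
  ↥(HHZ P n) ⧸ (Submodule.comap (HHZ P n).subtype (HHB P n ⊓ HHZ P n))

instance (P : DGBimod A) (n : ℤ) : AddCommGroup (HHspace P n) := by
  unfold HHspace; infer_instance

instance (P : DGBimod A) (n : ℤ) : Module k (HHspace P n) := by
  unfold HHspace; infer_instance

/-- `F : P → A` is an h-projective bimodule resolution of the diagonal bimodule. -/
def IsDiagResolution {A : DGAlgebra k} (P : DGBimod A) (F : BimodHom P (diagBimod A)) : Prop :=
  IsHoProjB P ∧ QIsoData P.gm P.D (diagBimod A).gm (diagBimod A).D F.f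
/-! ### Hom complexes and Ext spaces -/

/-- The degree-`n` part of the Hom complex of two right DG `A`-modules:
`A`-linear maps shifting degrees by `n`. -/
def homGrade (X Y : DGMod A) (n : ℤ) : Submodule k (X.M →ₗ[k] Y.M) where
  carrier := {f | (∀ (j : ℤ), ∀ m ∈ X.gm j, f m ∈ Y.gm (j + n)) ∧
    ∀ (x : A.R) (m : X.M), f (X.act x m) = Y.act x (f m)}
  add_mem' := by
    rintro f g ⟨hf1, hf2⟩ ⟨hg1, hg2⟩
    refine ⟨fun j m hm => ?_, fun x m => ?_⟩
    · exact (Y.gm (j + n)).add_mem (hf1 j m hm) (hg1 j m hm)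
    · simp [hf2, hg2]
  zero_mem' := by
    refine ⟨fun j m hm => (Y.gm (j + n)).zero_mem, fun x m => by simp⟩
  smul_mem' := by
    rintro c f ⟨hf1, hf2⟩
    refine ⟨fun j m hm => (Y.gm (j + n)).smul_mem c (hf1 j m hm), fun x m => ?_⟩
    simp [hf2]

theorem mem_homGrade {X Y : DGMod A} {n : ℤ} {f : X.M →ₗ[k] Y.M} :
    f ∈ homGrade X Y n ↔ ((∀ (j : ℤ), ∀ m ∈ X.gm j, f m ∈ Y.gm (j + n)) ∧
      ∀ (x : A.R) (m : X.M), f (X.act x m) = Y.act x (f m)) := Iff.rfl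

/-- The differential of the Hom complex in degree `n`:
`f ↦ D_Y ∘ f - (-1)^n f ∘ D_X`. -/
def homDop (X Y : DGMod A) (n : ℤ) : (X.M →ₗ[k] Y.M) →ₗ[k] (X.M →ₗ[k] Y.M) :=
  (LinearMap.llcomp k X.M Y.M Y.M) Y.D - sgnz n • (LinearMap.llcomp k X.M X.M Y.M).flip X.D

/-- Closed degree-`n` `A`-linear maps. -/
def ZHomS (X Y : DGMod A) (n : ℤ) : Submodule k (X.M →ₗ[k] Y.M) :=
  homGrade X Y n ⊓ LinearMap.ker (homDop X Y n)

/-- Degree-`n` boundaries of the Hom complex. -/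
def BHomS (X Y : DGMod A) (n : ℤ) : Submodule k (X.M →ₗ[k] Y.M) :=
  Submodule.map (homDop X Y (n - 1)) (homGrade X Y (n - 1))

/-- `Hom_{Ho(A)}(X, Y[n])`: the `n`-th cohomology of the Hom complex.  For
homotopically projective `X` this computes `Hom_{D(A)}(X, Y[n])`. -/
def ExtSpace (X Y : DGMod A) (n : ℤ) : Type :=
  ↥(ZHomS X Y n) ⧸ (Submodule.comap (ZHomS X Y n).subtype (BHomS X Y n ⊓ ZHomS X Y n))

instance (X Y : DGMod A) (n : ℤ) : AddCommGroup (ExtSpace X Y n) := by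
  unfold ExtSpace; infer_instance

instance (X Y : DGMod A) (n : ℤ) : Module k (ExtSpace X Y n) := by
  unfold ExtSpace; infer_instance

/-! ### Shifts, cones, isomorphisms in the homotopy category -/

/-- `X'` realizes the shift `X[t]` (so `X'^n = X^{n+t}`). -/
def IsShiftOf (X X' : DGMod A) (t : ℤ) : Prop :=
  ∃ g : X.M ≃ₗ[k] X'.M,
    (∀ n : ℤ, ∀ m ∈ X.gm (n + t), g m ∈ X'.gm n) ∧
    (∀ (x : A.R) (m : X.M), g (X.act x m) = X'.act x (g m)) ∧
    ∀ m : X.M, g (X.D m) = sgnz t • X'.D (g m)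

/-- `C` realizes the cone of the closed morphism `F : X → Y` with canonical
inclusion `j : Y → C`. -/
def IsConeOf {X Y : DGMod A} (F : DGHom X Y) (C : DGMod A) (j : DGHom Y C) : Prop :=
  ∃ (p : C.M →ₗ[k] X.M) (s : X.M →ₗ[k] C.M) (q : C.M →ₗ[k] Y.M),
    (∀ n : ℤ, ∀ c ∈ C.gm n, p c ∈ X.gm (n + 1)) ∧
    (∀ n : ℤ, ∀ m ∈ X.gm (n + 1), s m ∈ C.gm n) ∧
    (∀ n : ℤ, ∀ c ∈ C.gm n, q c ∈ Y.gm n) ∧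
    (∀ (x : A.R) (c : C.M), p (C.act x c) = X.act x (p c)) ∧
    (∀ (x : A.R) (m : X.M), s (X.act x m) = C.act x (s m)) ∧
    (∀ (x : A.R) (c : C.M), q (C.act x c) = Y.act x (q c)) ∧
    (∀ y : Y.M, q (j.f y) = y) ∧ (∀ m : X.M, p (s m) = m) ∧
    (∀ m : X.M, q (s m) = 0) ∧ (∀ y : Y.M, p (j.f y) = 0) ∧
    (∀ c : C.M, j.f (q c) + s (p c) = c) ∧
    ∀ m : X.M, C.D (s m) = j.f (F.f m) - s (X.D m)

/-- Isomorphism in the homotopy category of DG modules. -/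
def HoIso (X Y : DGMod A) : Prop :=
  ∃ (F : DGHom X Y) (G : DGHom Y X),
    Homotopic (G.comp F) (DGHom.id X) ∧ Homotopic (F.comp G) (DGHom.id Y)
/-! ### Left DG modules (right modules over `Aᵒᵖ`) and duality complexes -/

/-- A left DG module over `A` (equivalently, a right DG module over `Aᵒᵖ`). -/
structure DGModL (A : DGAlgebra k) : Type 1 where
  M : Type
  [acg : AddCommGroup M]
  [kmod : Module k M]
  gm : ℤ → Submodule k M
  [dec : DirectSum.Decomposition gm]
  actL : A.R →ₗ[k] M →ₗ[k] M
  actL_one : ∀ m : M, actL 1 m = m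
  actL_mul : ∀ (x y : A.R) (m : M), actL (x * y) m = actL x (actL y m)
  actL_deg : ∀ (i j : ℤ) (x : A.R) (m : M), x ∈ A.gr i → m ∈ gm j → actL x m ∈ gm (i + j)
  D : M →ₗ[k] M
  D_deg : ∀ (j : ℤ), ∀ m ∈ gm j, D m ∈ gm (j + 1)
  D_sq : ∀ m : M, D (D m) = 0
  leibnizL : ∀ (i j : ℤ) (x : A.R) (m : M), x ∈ A.gr i → m ∈ gm j →
    D (actL x m) = actL (A.d x) m + sgnz i • actL x (D m)

attribute [instance] DGModL.acg DGModL.kmod DGModL.dec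

/-- Morphisms of left DG modules. -/
structure DGHomL (X Y : DGModL A) where
  f : X.M →ₗ[k] Y.M
  deg : ∀ (j : ℤ), ∀ m ∈ X.gm j, f m ∈ Y.gm j
  actc : ∀ (x : A.R) (m : X.M), f (X.actL x m) = Y.actL x (f m)
  comm : ∀ m : X.M, f (X.D m) = Y.D (f m)

def DGHomL.id (X : DGModL A) : DGHomL X X :=
  ⟨LinearMap.id, fun _ _ h => h, fun _ _ => rfl, fun _ => rfl⟩

def DGHomL.comp {X Y Z : DGModL A} (G : DGHomL Y Z) (F : DGHomL X Y) : DGHomL X Z :=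
  ⟨G.f ∘ₗ F.f, fun j m h => G.deg j _ (F.deg j m h),
    fun x m => by simp [LinearMap.comp_apply, F.actc, G.actc],
    fun m => by simp [LinearMap.comp_apply, F.comm, G.comm]⟩

def HomotopicL {X Y : DGModL A} (F G : DGHomL X Y) : Prop :=
  ∃ h : X.M →ₗ[k] Y.M,
    (∀ (j : ℤ), ∀ m ∈ X.gm j, h m ∈ Y.gm (j - 1)) ∧
    (∀ (i : ℤ) (x : A.R), x ∈ A.gr i → ∀ m : X.M, h (X.actL x m) = sgnz i • Y.actL x (h m)) ∧
    ∀ m : X.M, F.f m - G.f m = Y.D (h m) + h (X.D m)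

def lSpan (X : DGModL A) (S : Set X.M) : Submodule k X.M :=
  sInf {p : Submodule k X.M | S ⊆ ↑p ∧ ∀ (x : A.R) (m : X.M), m ∈ p → X.actL x m ∈ p}

def IsTwistedL (T : DGModL A) : Prop :=
  ∃ (s : ℕ) (r : Fin s → ℤ) (e : Fin s → T.M),
    (∀ j, e j ∈ T.gm (-(r j))) ∧
    (∀ j, T.D (e j) ∈ lSpan T (e '' {i | i < j})) ∧
    Function.Bijective (fun v : Fin s → A.R => ∑ j, T.actL (v j) (e j))

def IsHoSummandL (P T : DGModL A) : Prop :=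
  ∃ (ι : DGHomL P T) (ρ : DGHomL T P), HomotopicL (ρ.comp ι) (DGHomL.id P)

def IsPerfectL (N : DGModL A) : Prop :=
  ∃ T P : DGModL A, IsTwistedL T ∧ IsHoSummandL P T ∧
    ∃ F : DGHomL P N, QIsoData P.gm P.D N.gm N.D F.f

/-- The degree-`n` part of the complex `Hom_A(X, A)` of right `A`-module maps into `A`. -/
def rHomGrade (X : DGMod A) (n : ℤ) : Submodule k (X.M →ₗ[k] A.R) where
  carrier := {g | (∀ (j : ℤ), ∀ m ∈ X.gm j, g m ∈ A.gr (j + n)) ∧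
    ∀ (x : A.R) (m : X.M), g (X.act x m) = g m * x}
  add_mem' := by
    rintro f g ⟨hf1, hf2⟩ ⟨hg1, hg2⟩
    exact ⟨fun j m hm => (A.gr (j + n)).add_mem (hf1 j m hm) (hg1 j m hm),
      fun x m => by simp [hf2, hg2, add_mul]⟩
  zero_mem' := ⟨fun j m hm => (A.gr (j + n)).zero_mem, fun x m => by simp⟩
  smul_mem' := by
    rintro c f ⟨hf1, hf2⟩
    exact ⟨fun j m hm => (A.gr (j + n)).smul_mem c (hf1 j m hm),
      fun x m => by simp [hf2, Algebra.smul_mul_assoc]⟩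

/-- `V` realizes the dual complex `X^∨ = RHom_A(X, A)` of a (homotopically projective)
right DG module `X`, as a left DG module. -/
def IsRightDualOf (X : DGMod A) (V : DGModL A) : Prop :=
  ∃ Φ : V.M →ₗ[k] (X.M →ₗ[k] A.R),
    Function.Injective Φ ∧
    (∀ n : ℤ, Submodule.map Φ (V.gm n) = rHomGrade X n) ∧
    (∀ (n : ℤ), ∀ v ∈ V.gm n, Φ (V.D v) = A.d ∘ₗ Φ v - sgnz n • (Φ v ∘ₗ X.D)) ∧
    ∀ (x : A.R) (v : V.M), Φ (V.actL x v) = LinearMap.mul k A.R x ∘ₗ Φ v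

/-- The degree-`n` part of the complex `Hom_{Aᵒᵖ}(V, A)` of left `A`-module maps into `A`
(with Koszul signs for moving a degree-`n` map past a left action). -/
def lHomGrade (V : DGModL A) (n : ℤ) : Submodule k (V.M →ₗ[k] A.R) where
  carrier := {g | (∀ (j : ℤ), ∀ v ∈ V.gm j, g v ∈ A.gr (j + n)) ∧
    ∀ (i : ℤ) (x : A.R), x ∈ A.gr i → ∀ v : V.M, g (V.actL x v) = sgnz (i * n) • (x * g v)}
  add_mem' := by
    rintro f g ⟨hf1, hf2⟩ ⟨hg1, hg2⟩
    exact ⟨fun j v hv => (A.gr (j + n)).add_mem (hf1 j v hv) (hg1 j v hv),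
      fun i x hx v => by simp [hf2 i x hx, hg2 i x hx, mul_add, smul_add]⟩
  zero_mem' := ⟨fun j v hv => (A.gr (j + n)).zero_mem, fun i x hx v => by simp⟩
  smul_mem' := by
    rintro c f ⟨hf1, hf2⟩
    refine ⟨fun j v hv => (A.gr (j + n)).smul_mem c (hf1 j v hv), fun i x hx v => ?_⟩
    simp only [LinearMap.smul_apply, hf2 i x hx, Algebra.mul_smul_comm]
    rw [smul_comm]

/-- `W` realizes the bidual complex `Hom_{Aᵒᵖ}(V, A)` of a left DG module `V`,
as a right DG module. -/
def IsLeftDualOf (V : DGModL A) (W : DGMod A) : Prop :=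
  ∃ Ψ : W.M →ₗ[k] (V.M →ₗ[k] A.R),
    Function.Injective Ψ ∧
    (∀ n : ℤ, Submodule.map Ψ (W.gm n) = lHomGrade V n) ∧
    (∀ (n : ℤ), ∀ w ∈ W.gm n, Ψ (W.D w) = A.d ∘ₗ Ψ w - sgnz n • (Ψ w ∘ₗ V.D)) ∧
    ∀ (x : A.R) (w : W.M), Ψ (W.act x w) = (LinearMap.mul k A.R).flip x ∘ₗ Ψ w

/-- The degree-`j` part of the graded `k`-linear dual of a graded module:
functionals vanishing on all components of degree `≠ -j`. -/
def dualGrade {M : Type} [AddCommGroup M] [Module k M]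
    (gm : ℤ → Submodule k M) (j : ℤ) : Submodule k (M →ₗ[k] k) where
  carrier := {ν | ∀ l : ℤ, l ≠ -j → ∀ m ∈ gm l, ν m = 0}
  add_mem' := by
    intro f g hf hg l hl m hm
    simp [hf l hl m hm, hg l hl m hm]
  zero_mem' := by intro l hl m hm; simp
  smul_mem' := by
    intro c f hf l hl m hm
    simp [hf l hl m hm]

/-- `W` realizes the graded `k`-linear dual of a left DG module `V`, as a right DG
module (the Nakayama construction `V ↦ V^*`). -/
def IsGradedKDual (V : DGModL A) (W : DGMod A) : Prop :=
  ∃ Ψ : W.M →ₗ[k] (V.M →ₗ[k] k),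
    (∀ (n : ℤ), ∀ w ∈ W.gm n, Ψ w ∈ dualGrade V.gm n) ∧
    (∀ n : ℤ, Function.Bijective
      (fun w : ↥(W.gm n) => (Ψ ↑w) ∘ₗ (V.gm (-n)).subtype)) ∧
    (∀ (n : ℤ), ∀ w ∈ W.gm n, ∀ v : V.M, Ψ (W.D w) v = -(sgnz n) • Ψ w (V.D v)) ∧
    ∀ (i : ℤ) (x : A.R), x ∈ A.gr i → ∀ (n : ℤ), ∀ w ∈ W.gm n, ∀ v : V.M,
      Ψ (W.act x w) v = sgnz (i * n) • Ψ w (V.actL x v)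

/-- `W` realizes the Nakayama functor value `S_A(X) = (X^∨)^*`. -/
def IsNakayamaOf (X : DGMod A) (W : DGMod A) : Prop :=
  ∃ V : DGModL A, IsRightDualOf X V ∧ IsGradedKDual V W
/-! ### Graded tensor products, dual complexes, and bimodule Hom complexes -/

/-- The degree-`n` part of the tensor product of two graded modules. -/
def tenGrade {M₁ M₂ : Type} [AddCommGroup M₁] [Module k M₁] [AddCommGroup M₂] [Module k M₂]
    (gm₁ : ℤ → Submodule k M₁) (gm₂ : ℤ → Submodule k M₂) (n : ℤ) :
    Submodule k (M₁ ⊗[k] M₂) :=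
  Submodule.span k {t : M₁ ⊗[k] M₂ | ∃ (i j : ℤ) (x : M₁) (y : M₂),
    x ∈ gm₁ i ∧ y ∈ gm₂ j ∧ i + j = n ∧ t = x ⊗ₜ y}

/-- The differential `D₁ ⊗ 1 + σ₁ ⊗ D₂` on a tensor product of complexes, where `σ₁`
is the sign operator of the first factor. -/
def tenD {M₁ M₂ : Type} [AddCommGroup M₁] [Module k M₁] [AddCommGroup M₂] [Module k M₂]
    (D₁ : M₁ →ₗ[k] M₁) (s₁ : M₁ →ₗ[k] M₁) (D₂ : M₂ →ₗ[k] M₂) :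
    (M₁ ⊗[k] M₂) →ₗ[k] (M₁ ⊗[k] M₂) :=
  TensorProduct.map D₁ LinearMap.id + TensorProduct.map s₁ D₂

/-- Cycles of a quotient complex `M/K`, described by representatives in `M`. -/
def ZgK {M : Type} [AddCommGroup M] [Module k M]
    (gm : ℤ → Submodule k M) (Dm : M →ₗ[k] M) (K : Submodule k M) (n : ℤ) :
    Submodule k M :=
  gm n ⊓ K.comap Dm

/-- Boundaries of a quotient complex `M/K`, described by representatives in `M`. -/
def BgK {M : Type} [AddCommGroup M] [Module k M]
    (gm : ℤ → Submodule k M) (Dm : M →ₗ[k] M) (K : Submodule k M) (n : ℤ) :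
    Submodule k M :=
  gm n ⊓ (K ⊔ LinearMap.range Dm)

/-- The differential of the graded dual of a complex. -/
def dualD {M : Type} [AddCommGroup M] [Module k M]
    (gm : ℤ → Submodule k M) [DirectSum.Decomposition gm] (Dm : M →ₗ[k] M) :
    (M →ₗ[k] k) →ₗ[k] (M →ₗ[k] k) :=
  -((LinearMap.llcomp k M M k).flip (Dm ∘ₗ gop gm fun j => sgnk k (j + 1)))

/-- The left `A`-action on the dual `M^*` of a right DG `A`-module `M`. -/
def dualActL (M : DGMod A) (x : A.R) : (M.M →ₗ[k] k) →ₗ[k] (M.M →ₗ[k] k) :=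
  (LinearMap.llcomp k M.M M.M k).flip (M.act x)

/-- The relations submodule defining `X ⊗_A V` inside `X ⊗_k V` for a right module `X`
and a bimodule `V`. -/
def tenRelMB (X : DGMod A) (V : DGBimod A) : Submodule k (X.M ⊗[k] V.M) :=
  Submodule.span k {t : X.M ⊗[k] V.M | ∃ (a : A.R) (x : X.M) (v : V.M),
    t = (X.act a x) ⊗ₜ v - x ⊗ₜ (V.actL a v)}

/-- The relations submodule defining `U ⊗_A V` inside `U ⊗_k V` for two bimodules. -/
def tenRelBB (U V : DGBimod A) : Submodule k (U.M ⊗[k] V.M) :=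
  Submodule.span k {t : U.M ⊗[k] V.M | ∃ (a : A.R) (u : U.M) (v : V.M),
    t = (U.actR a u) ⊗ₜ v - u ⊗ₜ (V.actL a v)}

/-- `V` realizes the dual bimodule `A^* = Hom_k(A, k)` (with its canonical DG
`A`-bimodule structure induced from the diagonal bimodule `A`). -/
def IsDualDiagOf {A : DGAlgebra k} (V : DGBimod A) : Prop :=
  ∃ Ψ : V.M →ₗ[k] (A.R →ₗ[k] k),
    (∀ (n : ℤ), ∀ v ∈ V.gm n, Ψ v ∈ dualGrade A.gr n) ∧
    (∀ n : ℤ, Function.Bijective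
      (fun v : ↥(V.gm n) => (Ψ ↑v) ∘ₗ (A.gr (-n)).subtype)) ∧
    (∀ (n : ℤ), ∀ v ∈ V.gm n, ∀ b : A.R, Ψ (V.D v) b = -(sgnz n) • Ψ v (A.d b)) ∧
    (∀ (i : ℤ) (x : A.R), x ∈ A.gr i → ∀ (n : ℤ), ∀ v ∈ V.gm n, ∀ b : A.R,
      Ψ (V.actL x v) b = sgnz (i * n) • Ψ v (b * x)) ∧
    ∀ (x : A.R) (v : V.M) (b : A.R), Ψ (V.actR x v) b = Ψ v (x * b)

/-- The degree-`n` part of the bimodule Hom complex `Hom_{Aᵉ}(P, T)`, for a target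
complex `T` equipped with (degreewise) commuting `Aᵉ`-actions `actLT`, `actRT`. -/
def bheGrade (P : DGBimod A) {T : Type} [AddCommGroup T] [Module k T]
    (gmT : ℤ → Submodule k T) (actLT actRT : ℤ → A.R → T →ₗ[k] T) (n : ℤ) :
    Submodule k (P.M →ₗ[k] T) where
  carrier := {g | (∀ (j : ℤ), ∀ m ∈ P.gm j, g m ∈ gmT (j + n)) ∧
    (∀ (i : ℤ) (x : A.R), x ∈ A.gr i → ∀ m : P.M,
      g (P.actL x m) = sgnz (i * n) • actLT i x (g m)) ∧
    ∀ (i : ℤ) (x : A.R), x ∈ A.gr i → ∀ m : P.M, g (P.actR x m) = actRT i x (g m)}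
  add_mem' := by
    rintro f g ⟨hf1, hf2, hf3⟩ ⟨hg1, hg2, hg3⟩
    exact ⟨fun j m hm => (gmT (j + n)).add_mem (hf1 j m hm) (hg1 j m hm),
      fun i x hx m => by simp [hf2 i x hx, hg2 i x hx, smul_add],
      fun i x hx m => by simp [hf3 i x hx, hg3 i x hx]⟩
  zero_mem' := ⟨fun j m hm => (gmT (j + n)).zero_mem,
    fun i x hx m => by simp, fun i x hx m => by simp⟩
  smul_mem' := by
    rintro c f ⟨hf1, hf2, hf3⟩
    refine ⟨fun j m hm => (gmT (j + n)).smul_mem c (hf1 j m hm), fun i x hx m => ?_,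
      fun i x hx m => by simp [hf3 i x hx]⟩
    simp only [LinearMap.smul_apply, hf2 i x hx, map_smul]
    rw [smul_comm]

/-- The differential of the bimodule Hom complex in degree `n`. -/
def bhDop (P : DGBimod A) {T : Type} [AddCommGroup T] [Module k T]
    (DT : T →ₗ[k] T) (n : ℤ) : (P.M →ₗ[k] T) →ₗ[k] (P.M →ₗ[k] T) :=
  (LinearMap.llcomp k P.M T T) DT - sgnz n • (LinearMap.llcomp k P.M P.M T).flip P.D

/-- Closed degree-`n` elements of the bimodule Hom complex. -/
def ZbhS (P : DGBimod A) {T : Type} [AddCommGroup T] [Module k T]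
    (gmT : ℤ → Submodule k T) (actLT actRT : ℤ → A.R → T →ₗ[k] T)
    (DT : T →ₗ[k] T) (n : ℤ) : Submodule k (P.M →ₗ[k] T) :=
  bheGrade P gmT actLT actRT n ⊓ LinearMap.ker (bhDop P DT n)

/-- Boundaries of degree `n` of the bimodule Hom complex. -/
def BbhS (P : DGBimod A) {T : Type} [AddCommGroup T] [Module k T]
    (gmT : ℤ → Submodule k T) (actLT actRT : ℤ → A.R → T →ₗ[k] T)
    (DT : T →ₗ[k] T) (n : ℤ) : Submodule k (P.M →ₗ[k] T) :=
  Submodule.map (bhDop P DT (n - 1)) (bheGrade P gmT actLT actRT (n - 1))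

/-- Cohomology of the bimodule Hom complex (`Ext` over `Aᵉ`). -/
def ExtBSpace (P : DGBimod A) {T : Type} [AddCommGroup T] [Module k T]
    (gmT : ℤ → Submodule k T) (actLT actRT : ℤ → A.R → T →ₗ[k] T)
    (DT : T →ₗ[k] T) (n : ℤ) : Type :=
  ↥(ZbhS P gmT actLT actRT DT n) ⧸
    (Submodule.comap (ZbhS P gmT actLT actRT DT n).subtype
      (BbhS P gmT actLT actRT DT n ⊓ ZbhS P gmT actLT actRT DT n))

instance (P : DGBimod A) {T : Type} [AddCommGroup T] [Module k T]
    (gmT : ℤ → Submodule k T) (actLT actRT : ℤ → A.R → T →ₗ[k] T)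
    (DT : T →ₗ[k] T) (n : ℤ) : AddCommGroup (ExtBSpace P gmT actLT actRT DT n) := by
  unfold ExtBSpace; infer_instance

instance (P : DGBimod A) {T : Type} [AddCommGroup T] [Module k T]
    (gmT : ℤ → Submodule k T) (actLT actRT : ℤ → A.R → T →ₗ[k] T)
    (DT : T →ₗ[k] T) (n : ℤ) : Module k (ExtBSpace P gmT actLT actRT DT n) := by
  unfold ExtBSpace; infer_instance

/-- The differential of `Aᵉ` on the underlying space `A.R ⊗[k] A.R`. -/
def aeD (A : DGAlgebra k) : (A.R ⊗[k] A.R) →ₗ[k] (A.R ⊗[k] A.R) :=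
  tenD A.d (gop A.gr fun j => sgnk k j) A.d

/-- The inner (module) action of a homogeneous element of degree `i` on the left slot
of the free `Aᵉ`-module `Aᵉ`. -/
def aeInnerL (A : DGAlgebra k) (i : ℤ) (x : A.R) : (A.R ⊗[k] A.R) →ₗ[k] (A.R ⊗[k] A.R) :=
  TensorProduct.map (LinearMap.mulLeft k x) (gop A.gr fun j => sgnk k (i * j))

/-- The inner (module) action on the right slot of the free `Aᵉ`-module `Aᵉ`. -/
def aeInnerR (A : DGAlgebra k) (i : ℤ) (x : A.R) : (A.R ⊗[k] A.R) →ₗ[k] (A.R ⊗[k] A.R) :=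
  TensorProduct.map LinearMap.id (LinearMap.mulRight k x)

/-- The outer left action on the free `Aᵉ`-module `Aᵉ`. -/
def aeOuterL (A : DGAlgebra k) (i : ℤ) (x : A.R) : (A.R ⊗[k] A.R) →ₗ[k] (A.R ⊗[k] A.R) :=
  TensorProduct.map (LinearMap.mulRight k x) LinearMap.id

/-- The outer right action on the free `Aᵉ`-module `Aᵉ`. -/
def aeOuterR (A : DGAlgebra k) (i : ℤ) (x : A.R) : (A.R ⊗[k] A.R) →ₗ[k] (A.R ⊗[k] A.R) :=
  TensorProduct.map (gop A.gr fun j => sgnk k (i * j)) (LinearMap.mulLeft k x)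

/-- `E` represents the inverse dualizing bimodule
`A^! = RHom_{(Aᵉ)ᵒᵖ}(A, (Aᵉ)ᵒᵖ)`: `E` is identified, via `Φ`, with the bimodule Hom
complex `Hom_{Aᵉ}(P, Aᵉ)` for an h-projective bimodule resolution `P` of the diagonal. -/
def RepresentsShriek {A : DGAlgebra k} (E : DGBimod A) : Prop :=
  ∃ (P : DGBimod A) (F : BimodHom P (diagBimod A)), IsDiagResolution P F ∧
  ∃ Φ : E.M →ₗ[k] (P.M →ₗ[k] (A.R ⊗[k] A.R)),
    Function.Injective Φ ∧
    (∀ n : ℤ, Submodule.map Φ (E.gm n) =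
      bheGrade P (tenGrade A.gr A.gr) (aeInnerL A) (aeInnerR A) n) ∧
    (∀ (n : ℤ), ∀ v ∈ E.gm n, Φ (E.D v) = bhDop P (aeD A) n (Φ v)) ∧
    (∀ (i : ℤ) (x : A.R), x ∈ A.gr i → ∀ v : E.M,
      Φ (E.actL x v) = aeOuterL A i x ∘ₗ Φ v) ∧
    ∀ (i : ℤ) (x : A.R), x ∈ A.gr i → ∀ v : E.M,
      Φ (E.actR x v) = aeOuterR A i x ∘ₗ Φ v

/-- `C` realizes the DG algebra tensor product `A ⊗ₖ B` (with the Koszul sign rule). -/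
def IsTensorAlgOf {k : Type} [Field k] (A B C : DGAlgebra k) : Prop :=
  ∃ (iA : A.R →ₗ[k] C.R) (iB : B.R →ₗ[k] C.R),
    iA 1 = 1 ∧ iB 1 = 1 ∧
    (∀ x y : A.R, iA (x * y) = iA x * iA y) ∧
    (∀ x y : B.R, iB (x * y) = iB x * iB y) ∧
    (∀ (i : ℤ), ∀ x ∈ A.gr i, iA x ∈ C.gr i) ∧
    (∀ (j : ℤ), ∀ y ∈ B.gr j, iB y ∈ C.gr j) ∧
    (∀ (i j : ℤ) (x : A.R) (y : B.R), x ∈ A.gr i → y ∈ B.gr j →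
      iB y * iA x = sgnz (i * j) • (iA x * iB y)) ∧
    (∀ x : A.R, C.d (iA x) = iA (A.d x)) ∧
    (∀ y : B.R, C.d (iB y) = iB (B.d y)) ∧
    Function.Bijective (TensorProduct.lift
      ((LinearMap.mul k C.R ∘ₗ iA).compl₂ iB))

/-- `A'` realizes the opposite DG algebra `Aᵒᵖ` (with the Koszul sign rule). -/
def IsOppositeOf {k : Type} [Field k] (A A' : DGAlgebra k) : Prop :=
  ∃ φ : A.R ≃ₗ[k] A'.R,
    φ 1 = 1 ∧
    (∀ (i j : ℤ) (x y : A.R), x ∈ A.gr i → y ∈ A.gr j →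
      φ (x * y) = sgnz (i * j) • (φ y * φ x)) ∧
    (∀ (i : ℤ), ∀ x ∈ A.gr i, φ x ∈ A'.gr i) ∧
    ∀ x : A.R, φ (A.d x) = A'.d (φ x)

set_option linter.unusedVariables false

/-! Signs -/
theorem sgnz_cases (i : ℤ) : sgnz i = 1 ∨ sgnz i = -1 := by
  unfold sgnz; split_ifs <;> simp

theorem sgnz_add (i j : ℤ) : sgnz (i + j) = sgnz i * sgnz j := by
  simp only [sgnz, Int.even_add]; split_ifs <;> simp_all

theorem sgnz_even {i : ℤ} (h : Even i) : sgnz i = 1 := by simp [sgnz, h]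
theorem sgnz_odd {i : ℤ} (h : ¬ Even i) : sgnz i = -1 := by simp [sgnz, h]

theorem sgnk_smul {M : Type} [AddCommGroup M] [Module k M] (i : ℤ) (m : M) :
    sgnk k i • m = sgnz i • m := by
  unfold sgnk sgnz; split_ifs <;> simp

theorem sgnz_sq (i : ℤ) : sgnz i * sgnz i = 1 := by
  rcases sgnz_cases i with h | h <;> simp [h]

theorem sgnz_smul_smul {M : Type} [AddCommGroup M] (i : ℤ) (m : M) :
    sgnz i • sgnz i • m = m := by
  rw [smul_smul, sgnz_sq, one_smul]

/-! Graded modules -/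
section graded
variable {M N X : Type} [AddCommGroup M] [Module k M] [AddCommGroup N] [Module k N]
  [AddCommGroup X] [Module k X]
  (gm : ℤ → Submodule k M) [DirectSum.Decomposition gm]
  (gn : ℤ → Submodule k N) [DirectSum.Decomposition gn]

theorem gop_apply (c : ℤ → k) {j : ℤ} {m : M} (hm : m ∈ gm j) : gop gm c m = c j • m := by
  have h : DirectSum.decomposeLinearEquiv gm m = DirectSum.lof k ℤ (fun i => gm i) j ⟨m, hm⟩ :=
    DirectSum.decompose_of_mem gm hm
  simp only [gop, LinearMap.comp_apply, LinearEquiv.coe_coe, h, DirectSum.toModule_lof]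
  simp

theorem hom_ind {p : M → Prop} (h : ∀ j, ∀ m ∈ gm j, p m) (ha : ∀ x y, p x → p y → p (x + y))
    (m : M) : p m :=
  DirectSum.Decomposition.inductionOn gm (h 0 0 (gm 0).zero_mem) (fun {i} m => h i m m.2) ha m

theorem hom_ext {f g : M →ₗ[k] X} (h : ∀ j, ∀ m ∈ gm j, f m = g m) : f = g := by
  ext m
  exact hom_ind gm (p := fun m => f m = g m) h (fun x y hx hy => by simp [hx, hy]) m

theorem ten_ind {p : M ⊗[k] N → Prop}
    (h : ∀ i j, ∀ m ∈ gm i, ∀ n ∈ gn j, p (m ⊗ₜ n)) (ha : ∀ x y, p x → p y → p (x + y))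
    (t : M ⊗[k] N) : p t := by
  induction t with
  | zero => simpa using h 0 0 0 (gm 0).zero_mem 0 (gn 0).zero_mem
  | add x y hx hy => exact ha _ _ hx hy
  | tmul x y =>
    refine hom_ind gm (p := fun x => p (x ⊗ₜ y)) (fun i m hm => ?_)
      (fun a b ha' hb => by rw [TensorProduct.add_tmul]; exact ha _ _ ha' hb) x
    exact hom_ind gn (p := fun y => p (m ⊗ₜ y)) (fun j n hn => h i j m hm n hn)
      (fun a b ha' hb => by rw [TensorProduct.tmul_add]; exact ha _ _ ha' hb) y

theorem ten_ext {f g : M ⊗[k] N →ₗ[k] X}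
    (h : ∀ i j, ∀ m ∈ gm i, ∀ n ∈ gn j, f (m ⊗ₜ n) = g (m ⊗ₜ n)) : f = g := by
  ext1; ext m n
  exact ten_ind gm gn (p := fun t => f t = g t) h (fun x y hx hy => by simp [hx, hy]) (m ⊗ₜ n)

variable {gm gn} in
theorem mem_ten {i j n : ℤ} {x : M} {y : N} (hx : x ∈ gm i) (hy : y ∈ gn j) (h : i + j = n) :
    x ⊗ₜ[k] y ∈ tenGrade gm gn n := Submodule.subset_span ⟨i, j, x, y, hx, hy, h, rfl⟩

theorem tengr_ind {n : ℤ} {p : M ⊗[k] N → Prop}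
    (h : ∀ i j, i + j = n → ∀ m ∈ gm i, ∀ n ∈ gn j, p (m ⊗ₜ n))
    (ha : ∀ x y, p x → p y → p (x + y)) {t : M ⊗[k] N} (ht : t ∈ tenGrade gm gn n) : p t := by
  have key : ∀ c : k, p (c • t) := by
    refine Submodule.span_induction (p := fun t _ => ∀ c : k, p (c • t)) ?_ ?_ ?_ ?_ ht
    · rintro _ ⟨i, j, x, y, hx, hy, hij, rfl⟩ c
      rw [TensorProduct.smul_tmul']
      exact h i j hij _ ((gm i).smul_mem c hx) _ hy
    · intro c
      simpa using h n 0 (by simp) 0 (gm _).zero_mem 0 (gn 0).zero_mem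
    · intro x y _ _ hx hy c
      rw [smul_add]; exact ha _ _ (hx c) (hy c)
    · intro a x _ hx c
      rw [smul_smul]; exact hx _
  simpa using key 1

def tenDecAux : (M ⊗[k] N) →ₗ[k] ⨁ n, tenGrade gm gn n :=
  TensorProduct.lift
    ((DirectSum.toModule k ℤ _ (fun i =>
      (LinearMap.flip ((DirectSum.toModule k ℤ _ (fun j =>
        LinearMap.flip (LinearMap.mk₂ k
          (fun (x : gm i) (y : gn j) => DirectSum.lof k ℤ (fun n => tenGrade gm gn n) (i + j)
            ⟨(x : M) ⊗ₜ[k] (y : N), mem_ten x.2 y.2 rfl⟩)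
          (fun x x' y => by rw [← map_add]; congr 1; ext; simp [TensorProduct.add_tmul])
          (fun c x y => by rw [← map_smul]; congr 1; )
          (fun x y y' => by rw [← map_add]; congr 1; ext; simp [TensorProduct.tmul_add])
          (fun c x y => by rw [← map_smul]; congr 1; ext; simp )))) ∘ₗ
      (DirectSum.decomposeLinearEquiv gn).toLinearMap)))) ∘ₗ
      (DirectSum.decomposeLinearEquiv gm).toLinearMap)

theorem tenDecAux_apply {i j : ℤ} {x : M} {y : N} (hx : x ∈ gm i) (hy : y ∈ gn j) :
    tenDecAux gm gn (x ⊗ₜ y) = DirectSum.lof k ℤ (fun n => tenGrade gm gn n) (i + j)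
            ⟨x ⊗ₜ[k] y, mem_ten hx hy rfl⟩ := by
  have h1 := DirectSum.decompose_of_mem gm hx
  have h2 := DirectSum.decompose_of_mem gn hy
  simp only [tenDecAux, TensorProduct.lift.tmul, LinearMap.comp_apply, LinearEquiv.coe_coe,
    DirectSum.decomposeLinearEquiv_apply, h1]
  erw [DirectSum.toModule_lof]
  simp only [LinearMap.flip_apply, LinearMap.comp_apply, LinearEquiv.coe_coe,
    DirectSum.decomposeLinearEquiv_apply, h2]
  erw [DirectSum.toModule_lof]
  rfl

instance tenDec : DirectSum.Decomposition (tenGrade gm gn) :=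
  DirectSum.Decomposition.ofLinearMap _ (tenDecAux gm gn)
    (by
      apply ten_ext gm gn
      intro i j m hm n hn
      simp only [LinearMap.comp_apply, tenDecAux_apply gm gn hm hn]
      erw [DirectSum.coeLinearMap_lof]; rfl)
    (by
      apply DirectSum.linearMap_ext
      intro n
      ext1 ⟨t, ht⟩
      have : ∀ h : t ∈ tenGrade gm gn n, tenDecAux gm gn t =
          DirectSum.lof k ℤ (fun n => tenGrade gm gn n) n ⟨t, h⟩ := by
        refine tengr_ind gm gn (p := fun t => t ∈ tenGrade gm gn n ∧
          ∀ h : t ∈ tenGrade gm gn n, tenDecAux gm gn t =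
          DirectSum.lof k ℤ (fun n => tenGrade gm gn n) n ⟨t, h⟩) ?_ ?_ ht |>.2
        · rintro i j rfl m hm n hn
          exact ⟨mem_ten hm hn rfl, fun h => tenDecAux_apply gm gn hm hn⟩
        · intro x y hx hy
          refine ⟨Submodule.add_mem _ hx.1 hy.1, fun h => ?_⟩
          rw [map_add, hx.2 hx.1, hy.2 hy.1, ← map_add]
          rfl
      simp only [LinearMap.comp_apply]
      erw [DirectSum.coeLinearMap_lof]
      exact this ht)

end graded


section kun
variable {M N X : Type} [AddCommGroup M] [Module k M] [AddCommGroup N] [Module k N]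
  [AddCommGroup X] [Module k X]

theorem contract {K : Type} [AddCommGroup K] [Module k K] (D : K →ₗ[k] K)
    (hD : ∀ x, D (D x) = 0) (hac : ∀ x, D x = 0 → ∃ y, D y = x) :
    ∃ h : K →ₗ[k] K, ∀ x, D (h x) + h (D x) = x := by
  have hr : LinearMap.range (D.codRestrict (LinearMap.ker D) (fun x => hD x)) = ⊤ := by
    rw [LinearMap.range_eq_top]
    rintro ⟨x, hx⟩
    obtain ⟨y, hy⟩ := hac x hx
    exact ⟨y, Subtype.ext hy⟩
  obtain ⟨s0, hs0⟩ := LinearMap.exists_rightInverse_of_surjective _ hr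
  obtain ⟨s, hs⟩ := LinearMap.exists_extend s0
  have hs' : ∀ z, D z = 0 → D (s z) = z := by
    intro z hz
    have h1 : s z = s0 ⟨z, hz⟩ := by rw [← hs]; rfl
    have h2 := congrArg Subtype.val (LinearMap.congr_fun hs0 ⟨z, hz⟩)
    rw [h1]; exact h2
  refine ⟨s - s ∘ₗ s ∘ₗ D, fun x => ?_⟩
  have h3 : D (s (x - s (D x))) = x - s (D x) := hs' _ (by rw [map_sub, hs' _ (hD x), sub_self])
  simp only [LinearMap.sub_apply, LinearMap.comp_apply, hD, map_zero, sub_zero]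
  rw [← map_sub, h3]; abel

/-- ungraded homotopy inverse -/
theorem hoinv {D₁ : M →ₗ[k] M} {D₂ : N →ₗ[k] N} (h1 : ∀ x, D₁ (D₁ x) = 0)
    (h2 : ∀ x, D₂ (D₂ x) = 0) (f : M →ₗ[k] N) (hf : ∀ x, f (D₁ x) = D₂ (f x))
    (hs : ∀ z, D₂ z = 0 → ∃ w y, D₁ w = 0 ∧ f w - z = D₂ y)
    (hi : ∀ w y, D₁ w = 0 → f w = D₂ y → ∃ x, w = D₁ x) :
    ∃ (g : N →ₗ[k] M) (u : M →ₗ[k] M) (v : N →ₗ[k] N),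
      (∀ x, g (D₂ x) = D₁ (g x)) ∧ (∀ x, g (f x) - x = D₁ (u x) + u (D₁ x)) ∧
      (∀ x, f (g x) - x = D₂ (v x) + v (D₂ x)) := by
  let D : (M × N) →ₗ[k] (M × N) :=
    LinearMap.prod (-(D₁ ∘ₗ LinearMap.fst k M N)) (f ∘ₗ LinearMap.fst k M N + D₂ ∘ₗ LinearMap.snd k M N)
  have hDa : ∀ x y, D (x, y) = (-(D₁ x), f x + D₂ y) := fun x y => rfl
  obtain ⟨h, hh⟩ := contract D (by
      rintro ⟨x, y⟩; simp [hDa, h1, h2, hf]) (by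
      rintro ⟨x, y⟩ hxy
      rw [hDa, Prod.mk_eq_zero, neg_eq_zero] at hxy
      obtain ⟨hx, hy⟩ := hxy
      obtain ⟨x', rfl⟩ := hi x (-y) hx (by rw [map_neg]; exact eq_neg_of_add_eq_zero_left hy)
      -- now f x' + y is a cycle
      obtain ⟨w, y', hw, hwy⟩ := hs (y + f x') (by rw [map_add, ← hf, add_comm]; exact hy)
      refine ⟨(w - x', -y'), ?_⟩
      rw [hDa, Prod.mk.injEq]
      refine ⟨by simp [hw], ?_⟩
      rw [map_neg, ← hwy, map_sub]; abel)
  refine ⟨LinearMap.fst k M N ∘ₗ h ∘ₗ LinearMap.inr k M N,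
    LinearMap.fst k M N ∘ₗ h ∘ₗ LinearMap.inl k M N,
    -(LinearMap.snd k M N ∘ₗ h ∘ₗ LinearMap.inr k M N), fun x => ?_, fun x => ?_, fun x => ?_⟩
  · have := congrArg Prod.fst (hh (0, x))
    rw [hDa] at this
    rw [show h (0, x) = ((h (0, x)).1, (h (0, x)).2) from rfl, hDa] at this
    simp at this
    simp
    rw [add_comm] at this; exact add_neg_eq_zero.1 this
  · have := congrArg Prod.fst (hh (x, 0))
    rw [hDa] at this
    rw [show h (x, 0) = ((h (x, 0)).1, (h (x, 0)).2) from rfl, hDa] at this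
    simp at this
    have e : h (-(D₁ x), f x) = - h (D₁ x, 0) + h (0, f x) := by
      rw [← map_neg h, ← map_add]; simp
    rw [e] at this
    simp at this ⊢
    nth_rw 2 [← this]; abel
  · have := congrArg Prod.snd (hh (0, x))
    rw [hDa] at this
    rw [show h (0, x) = ((h (0, x)).1, (h (0, x)).2) from rfl, hDa] at this
    simp at this
    simp
    nth_rw 2 [← this]; abel

variable (gm : ℤ → Submodule k M) [DirectSum.Decomposition gm]
  (gn : ℤ → Submodule k N) [DirectSum.Decomposition gn]
  (gx : ℤ → Submodule k X) [DirectSum.Decomposition gx]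

/-- projection to a component -/
def prj (j : ℤ) : M →ₗ[k] M := gop gm (fun i => if i = j then 1 else 0)

theorem prj_same {j : ℤ} {m : M} (hm : m ∈ gm j) : prj gm j m = m := by
  rw [prj, gop_apply gm _ hm]; simp
theorem prj_ne {i j : ℤ} {m : M} (hm : m ∈ gm i) (h : i ≠ j) : prj gm j m = 0 := by
  rw [prj, gop_apply gm _ hm]; simp [h]

theorem prj_mem (j : ℤ) (m : M) : prj gm j m ∈ gm j := by
  refine hom_ind gm (p := fun m => prj gm j m ∈ gm j) (fun i m hm => ?_)
    (fun x y hx hy => by rw [map_add]; exact Submodule.add_mem _ hx hy) m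
  by_cases h : i = j
  · subst h; rw [prj_same gm hm]; exact hm
  · rw [prj_ne gm hm h]; exact Submodule.zero_mem _

theorem prj_comm (f : M →ₗ[k] N) (d : ℤ) (hf : ∀ j, ∀ m ∈ gm j, f m ∈ gn (j + d)) (j : ℤ) (m : M) :
    prj gn (j + d) (f m) = f (prj gm j m) := by
  refine hom_ind gm (p := fun m => prj gn (j + d) (f m) = f (prj gm j m)) (fun i m hm => ?_)
    (fun x y hx hy => by simp only [map_add, hx, hy]) m
  by_cases h : i = j
  · subst h; rw [prj_same gm hm, prj_same gn (hf _ _ hm)]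
  · rw [prj_ne gm hm h, prj_ne gn (hf _ _ hm) (by omega), map_zero]

theorem prj_sum (m : M) : ∃ s : Finset ℤ, m = ∑ j ∈ s, prj gm j m := by
  have e : ∀ j, ((DirectSum.decompose gm m j : gm j) : M) = prj gm j m := by
    intro j
    refine hom_ind gm (p := fun m => ((DirectSum.decompose gm m j : gm j) : M) = prj gm j m)
      (fun i m hm => ?_) (fun x y hx hy => by simp [hx, hy]) m
    by_cases h : i = j
    · subst h; rw [prj_same gm hm, DirectSum.decompose_of_mem_same gm hm]
    · rw [prj_ne gm hm h, DirectSum.decompose_of_mem_ne gm hm h]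
  classical
  refine ⟨(DirectSum.decompose gm m).support, ?_⟩
  conv_lhs => rw [← DirectSum.sum_support_decompose gm m]
  exact Finset.sum_congr rfl (fun j _ => e j)

/-- homogenization -/
def hmg (d : ℤ) (f : M →ₗ[k] N) : M →ₗ[k] N :=
  (DirectSum.toModule k ℤ N (fun j => prj gn (j + d) ∘ₗ f ∘ₗ (gm j).subtype)) ∘ₗ
    (DirectSum.decomposeLinearEquiv gm).toLinearMap

theorem hmg_apply (d : ℤ) (f : M →ₗ[k] N) {j : ℤ} {m : M} (hm : m ∈ gm j) :
    hmg gm gn d f m = prj gn (j + d) (f m) := by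
  have h : DirectSum.decomposeLinearEquiv gm m = DirectSum.lof k ℤ (fun i => gm i) j ⟨m, hm⟩ :=
    DirectSum.decompose_of_mem gm hm
  simp only [hmg, LinearMap.comp_apply, LinearEquiv.coe_coe, h, DirectSum.toModule_lof]
  simp

theorem hmg_deg (d : ℤ) (f : M →ₗ[k] N) (j : ℤ) (m : M) (hm : m ∈ gm j) :
    hmg gm gn d f m ∈ gn (j + d) := by
  rw [hmg_apply gm gn d f hm]; exact prj_mem _ _ _

/-- graded homotopy inverse -/
theorem gr_hoinv {D₁ : M →ₗ[k] M} {D₂ : N →ₗ[k] N} (h1 : ∀ x, D₁ (D₁ x) = 0)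
    (h2 : ∀ x, D₂ (D₂ x) = 0) (d1 : ∀ j, ∀ x ∈ gm j, D₁ x ∈ gm (j + 1))
    (d2 : ∀ j, ∀ x ∈ gn j, D₂ x ∈ gn (j + 1))
    (f : M →ₗ[k] N) (hf : ∀ x, f (D₁ x) = D₂ (f x)) (fd : ∀ j, ∀ x ∈ gm j, f x ∈ gn j)
    (hq : QIsoData gm D₁ gn D₂ f) :
    ∃ (g : N →ₗ[k] M) (u : M →ₗ[k] M) (v : N →ₗ[k] N),
      (∀ j, ∀ x ∈ gn j, g x ∈ gm j) ∧ (∀ j, ∀ x ∈ gm j, u x ∈ gm (j - 1)) ∧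
      (∀ j, ∀ x ∈ gn j, v x ∈ gn (j - 1)) ∧
      (∀ x, g (D₂ x) = D₁ (g x)) ∧ (∀ x, g (f x) - x = D₁ (u x) + u (D₁ x)) ∧
      (∀ x, f (g x) - x = D₂ (v x) + v (D₂ x)) := by
  obtain ⟨-, -, hq⟩ := hq
  obtain ⟨g, u, v, hg, hu, hv⟩ := hoinv h1 h2 f hf (by
      intro z hz
      have hc : ∀ j, ∃ w y, D₁ w = 0 ∧ f w - prj gn j z = D₂ y := by
        intro j
        obtain ⟨w, hw, hw2⟩ := (hq j).1 (prj gn j z) ⟨prj_mem _ _ _, by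
          change D₂ _ = 0; rw [← prj_comm gn gn D₂ 1 d2, hz, map_zero]⟩
        obtain ⟨y, hy⟩ := hw2.2
        exact ⟨w, y, hw.2, hy.symm⟩
      choose w y hw hy using hc
      obtain ⟨s, hs⟩ := prj_sum gn z
      refine ⟨∑ j ∈ s, w j, ∑ j ∈ s, y j, ?_, ?_⟩
      · rw [map_sum]; exact Finset.sum_eq_zero (fun j _ => hw j)
      · conv_lhs => rw [hs]
        rw [map_sum, map_sum, ← Finset.sum_sub_distrib]
        exact Finset.sum_congr rfl (fun j _ => hy j)) (by
      intro w y hw hwy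
      have hc : ∀ j, ∃ x, prj gm j w = D₁ x := by
        intro j
        obtain ⟨x, hx⟩ := ((hq j).2 (prj gm j w) ⟨prj_mem _ _ _, by
          change D₁ _ = 0; rw [← prj_comm gm gm D₁ 1 d1, hw, map_zero]⟩
          ⟨fd _ _ (prj_mem _ _ _), prj gn (j - 1) y, by
            rw [← prj_comm gn gn D₂ 1 d2, ← hwy]
            have := prj_comm gm gn f 0 (by simpa using fd) j w
            simpa using this⟩).2
        exact ⟨x, hx.symm⟩
      choose x hx using hc
      obtain ⟨s, hs⟩ := prj_sum gm w
      refine ⟨∑ j ∈ s, x j, ?_⟩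
      conv_lhs => rw [hs]
      rw [map_sum]
      exact Finset.sum_congr rfl (fun j _ => hx j))
  refine ⟨hmg gn gm 0 g, hmg gm gm (-1) u, hmg gn gn (-1) v, ?_, ?_, ?_, ?_, ?_, ?_⟩
  · simpa using hmg_deg gn gm 0 g
  · exact hmg_deg gm gm (-1) u
  · exact hmg_deg gn gn (-1) v
  · intro x
    refine hom_ind gn (p := fun x => hmg gn gm 0 g (D₂ x) = D₁ (hmg gn gm 0 g x)) (fun j m hm => ?_)
      (fun x y hx hy => by simp only [map_add, hx, hy]) x
    rw [hmg_apply gn gm 0 g hm, hmg_apply gn gm 0 g (d2 j m hm), hg, ← prj_comm gm gm D₁ 1 d1]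
    congr 2; ring
  · intro x
    refine hom_ind gm (p := fun x => hmg gn gm 0 g (f x) - x =
      D₁ (hmg gm gm (-1) u x) + hmg gm gm (-1) u (D₁ x)) (fun j m hm => ?_)
      (fun x y hx hy => by simp only [map_add, add_sub_add_comm, hx, hy]; abel) x
    rw [hmg_apply gn gm 0 g (fd j m hm), hmg_apply gm gm _ u (d1 j m hm), hmg_apply gm gm _ u hm,
      ← prj_comm gm gm D₁ 1 d1]
    have := congrArg (prj gm j) (hu m)
    rw [map_sub, map_add, prj_same gm hm] at this
    simpa using this
  · intro x
    refine hom_ind gn (p := fun x => f (hmg gn gm 0 g x) - x =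
      D₂ (hmg gn gn (-1) v x) + hmg gn gn (-1) v (D₂ x)) (fun j m hm => ?_)
      (fun x y hx hy => by simp only [map_add, add_sub_add_comm, hx, hy]; abel) x
    rw [hmg_apply gn gm 0 g hm, hmg_apply gn gn _ v (d2 j m hm), hmg_apply gn gn _ v hm,
      ← prj_comm gn gn D₂ 1 d2]
    have := congrArg (prj gn j) (hv m)
    rw [map_sub, map_add, prj_same gn hm] at this
    have h3 := prj_comm gm gn f 0 (by simpa using fd) j (g m)
    simp only [add_zero] at h3 ⊢
    rw [← h3]
    simpa using this

variable {gm gn} in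
/-- homotopy equivalences are quasi-isomorphisms -/
theorem qiso_of_hoequiv {D₁ : M →ₗ[k] M} {D₂ : N →ₗ[k] N}
    (f : M →ₗ[k] N) (hf : ∀ x, f (D₁ x) = D₂ (f x)) (fd : ∀ j, ∀ x ∈ gm j, f x ∈ gn j)
    (g : N →ₗ[k] M) (u : M →ₗ[k] M) (v : N →ₗ[k] N)
    (hgd : ∀ j, ∀ x ∈ gn j, g x ∈ gm j)
    (hg : ∀ x, g (D₂ x) = D₁ (g x)) (hu : ∀ x, g (f x) - x = D₁ (u x) + u (D₁ x))
    (hv : ∀ x, f (g x) - x = D₂ (v x) + v (D₂ x)) : QIsoData gm D₁ gn D₂ f := by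
  refine ⟨?_, ?_, fun n => ⟨?_, ?_⟩⟩
  · rintro n x ⟨hx, hx2⟩
    exact ⟨fd _ _ hx, by change D₁ x = 0 at hx2; change D₂ _ = 0; rw [← hf, hx2, map_zero]⟩
  · rintro n x ⟨hx, y, rfl⟩
    exact ⟨fd _ _ hx, f y, (hf y).symm⟩
  · rintro z ⟨hz, hz2⟩
    change D₂ z = 0 at hz2
    refine ⟨g z, ⟨hgd _ _ hz, by change D₁ _ = 0; rw [← hg, hz2, map_zero]⟩,
      Submodule.sub_mem _ (fd _ _ (hgd _ _ hz)) hz, v z, ?_⟩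
    rw [hv, hz2, map_zero, add_zero]
  · rintro w ⟨hw, hw2⟩ ⟨hfw, y, hy⟩
    change D₁ w = 0 at hw2
    refine ⟨hw, g y - u w, ?_⟩
    have := hu w
    rw [hw2, map_zero, add_zero, ← hy, hg] at this
    rw [map_sub, ← this]; abel

variable {gm gn gx} in
theorem qiso_comp_equiv {D₁ : M →ₗ[k] M} {D₂ : N →ₗ[k] N} {D₃ : X →ₗ[k] X}
    {f : M →ₗ[k] N} (hq : QIsoData gm D₁ gn D₂ f) (e : N ≃ₗ[k] X)
    (ed : ∀ j, ∀ x ∈ gn j, e x ∈ gx j) (ed' : ∀ j, ∀ x, e x ∈ gx j → x ∈ gn j)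
    (he : ∀ x, e (D₂ x) = D₃ (e x)) : QIsoData gm D₁ gx D₃ (e.toLinearMap ∘ₗ f) := by
  have hB : ∀ n x, e x ∈ Bg gx D₃ n ↔ x ∈ Bg gn D₂ n := by
    intro n x
    constructor
    · rintro ⟨h, y, hy⟩
      refine ⟨ed' _ _ h, e.symm y, e.injective ?_⟩
      rw [he, ← hy]; simp
    · rintro ⟨h, y, rfl⟩
      exact ⟨ed _ _ h, e y, (he y).symm⟩
  have hZ : ∀ n x, e x ∈ Zg gx D₃ n ↔ x ∈ Zg gn D₂ n := by
    intro n x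
    constructor
    · rintro ⟨h, hy⟩
      refine ⟨ed' _ _ h, e.injective ?_⟩
      rw [he, map_zero]; exact hy
    · rintro ⟨h, hy⟩
      refine ⟨ed _ _ h, ?_⟩
      change D₂ x = 0 at hy
      change D₃ _ = 0
      rw [← he, hy, map_zero]
  obtain ⟨q1, q2, q3⟩ := hq
  refine ⟨fun n x hx => (hZ _ _).2 (q1 n x hx), fun n x hx => (hB _ _).2 (q2 n x hx),
    fun n => ⟨fun z hz => ?_, fun w hw h => (q3 n).2 w hw ((hB _ _).1 h)⟩⟩
  obtain ⟨z, rfl⟩ := e.surjective z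
  obtain ⟨w, hw, h⟩ := (q3 n).1 z ((hZ _ _).1 hz)
  refine ⟨w, hw, ?_⟩
  have := (hB _ _).2 h
  rwa [map_sub] at this

variable {gm gn} in
theorem equiv_gr (e : M ≃ₗ[k] N) (ed : ∀ j, ∀ x ∈ gm j, e x ∈ gn j) (j : ℤ) (x : M)
    (hx : e x ∈ gn j) : x ∈ gm j := by
  have := prj_comm gm gn e.toLinearMap 0 (by simpa using ed) j x
  simp only [add_zero, LinearEquiv.coe_coe] at this
  rw [prj_same gn hx] at this
  rw [e.injective this]; exact prj_mem _ _ _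

end kun

set_option linter.unusedSectionVars false

section tenh
variable {M N M' N' : Type} [AddCommGroup M] [Module k M] [AddCommGroup N] [Module k N]
  [AddCommGroup M'] [Module k M'] [AddCommGroup N'] [Module k N']
  (gm : ℤ → Submodule k M) [DirectSum.Decomposition gm]
  (gn : ℤ → Submodule k N) [DirectSum.Decomposition gn]
  (gm' : ℤ → Submodule k M') [DirectSum.Decomposition gm']
  (gn' : ℤ → Submodule k N') [DirectSum.Decomposition gn']

/-- sign operator -/
def sg : M →ₗ[k] M := gop gm (fun j => sgnk k j)
theorem sg_apply {j : ℤ} {m : M} (hm : m ∈ gm j) : sg gm m = sgnz j • m := by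
  rw [sg, gop_apply gm _ hm, sgnk_smul]

/-- the tensor differential -/
def tD (D₁ : M →ₗ[k] M) (D₂ : N →ₗ[k] N) : (M ⊗[k] N) →ₗ[k] (M ⊗[k] N) := tenD D₁ (sg gm) D₂

theorem tD_apply (D₁ : M →ₗ[k] M) (D₂ : N →ₗ[k] N) {j : ℤ} {m : M} (hm : m ∈ gm j) (n : N) :
    tD gm D₁ D₂ (m ⊗ₜ n) = D₁ m ⊗ₜ n + sgnz j • (m ⊗ₜ D₂ n) := by
  simp [tD, tenD, sg_apply gm hm, TensorProduct.smul_tmul']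

theorem zs_tmul (c : ℤ) (m : M) (n : N) : (c • m) ⊗ₜ[k] n = c • (m ⊗ₜ[k] n) := by
  rw [TensorProduct.smul_tmul']
theorem tmul_zs (c : ℤ) (m : M) (n : N) : m ⊗ₜ[k] (c • n) = c • (m ⊗ₜ[k] n) := by
  rw [TensorProduct.tmul_smul]

theorem tD_deg {D₁ : M →ₗ[k] M} {D₂ : N →ₗ[k] N} (d1 : ∀ j, ∀ x ∈ gm j, D₁ x ∈ gm (j + 1))
    (d2 : ∀ j, ∀ x ∈ gn j, D₂ x ∈ gn (j + 1)) (j : ℤ) (t : M ⊗[k] N) (ht : t ∈ tenGrade gm gn j) :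
    tD gm D₁ D₂ t ∈ tenGrade gm gn (j + 1) := by
  refine tengr_ind gm gn (p := fun t => tD gm D₁ D₂ t ∈ tenGrade gm gn (j + 1)) ?_
    (fun x y hx hy => by rw [map_add]; exact Submodule.add_mem _ hx hy) ht
  rintro p q rfl m hm n hn
  rw [tD_apply gm D₁ D₂ hm]
  exact Submodule.add_mem _ (mem_ten (d1 _ _ hm) hn (by ring))
    (zsmul_mem (mem_ten hm (d2 _ _ hn) (by ring)) _)

theorem tD_sq {D₁ : M →ₗ[k] M} {D₂ : N →ₗ[k] N} (h1 : ∀ x, D₁ (D₁ x) = 0)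
    (h2 : ∀ x, D₂ (D₂ x) = 0) (d1 : ∀ j, ∀ x ∈ gm j, D₁ x ∈ gm (j + 1))
    (t : M ⊗[k] N) : tD gm D₁ D₂ (tD gm D₁ D₂ t) = 0 := by
  induction t with
  | zero => simp
  | add x y hx hy => simp [hx, hy]
  | tmul m n =>
    refine hom_ind gm (p := fun m => tD gm D₁ D₂ (tD gm D₁ D₂ (m ⊗ₜ n)) = 0) (fun j m hm => ?_)
      (fun x y hx hy => by simp only [TensorProduct.add_tmul, map_add, hx, hy, add_zero]) m
    rw [tD_apply gm _ _ hm, map_add, map_zsmul, tD_apply gm _ _ hm, tD_apply gm _ _ (d1 _ _ hm)]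
    simp only [h1, h2, TensorProduct.zero_tmul, TensorProduct.tmul_zero, smul_zero, sgnz_add]
    rw [show sgnz 1 = -1 from sgnz_odd (by decide)]
    module

theorem map_deg {F : M →ₗ[k] M'} {G : N →ₗ[k] N'} (a b : ℤ)
    (Fd : ∀ j, ∀ x ∈ gm j, F x ∈ gm' (j + a))
    (Gd : ∀ j, ∀ x ∈ gn j, G x ∈ gn' (j + b)) (j : ℤ) (t : M ⊗[k] N) (ht : t ∈ tenGrade gm gn j) :
    TensorProduct.map F G t ∈ tenGrade gm' gn' (j + (a + b)) := by
  refine tengr_ind gm gn (p := fun t => TensorProduct.map F G t ∈ tenGrade gm' gn' (j + (a + b))) ?_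
    (fun x y hx hy => by rw [map_add]; exact Submodule.add_mem _ hx hy) ht
  rintro p q rfl m hm n hn
  exact mem_ten (Fd _ _ hm) (Gd _ _ hn) (by ring)

variable {D₁ : M →ₗ[k] M} {D₂ : N →ₗ[k] N} {D₁' : M' →ₗ[k] M'} {D₂' : N' →ₗ[k] N'}

theorem map_tD {F : M →ₗ[k] M'} {G : N →ₗ[k] N'}
    (Fd : ∀ j, ∀ x ∈ gm j, F x ∈ gm' j)
    (hF : ∀ x, F (D₁ x) = D₁' (F x)) (hG : ∀ x, G (D₂ x) = D₂' (G x)) (t : M ⊗[k] N) :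
    TensorProduct.map F G (tD gm D₁ D₂ t) = tD gm' D₁' D₂' (TensorProduct.map F G t) := by
  induction t with
  | zero => simp
  | add x y hx hy => simp [hx, hy]
  | tmul m n =>
    refine hom_ind gm (p := fun m => TensorProduct.map F G (tD gm D₁ D₂ (m ⊗ₜ n)) =
      tD gm' D₁' D₂' (TensorProduct.map F G (m ⊗ₜ n))) (fun j m hm => ?_)
      (fun x y hx hy => by simp only [TensorProduct.add_tmul, map_add, hx, hy]) m
    rw [tD_apply gm _ _ hm, TensorProduct.map_tmul, tD_apply gm' _ _ (Fd _ _ hm)]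
    simp [hF, hG]

/-- the tensor homotopy -/
def tenHt (hA : M →ₗ[k] M') (G : N →ₗ[k] N') (F' : M →ₗ[k] M') (hB : N →ₗ[k] N') :
    (M ⊗[k] N) →ₗ[k] (M' ⊗[k] N') :=
  TensorProduct.map hA G + TensorProduct.map (F' ∘ₗ sg gm) hB

theorem tenHt_apply (hA : M →ₗ[k] M') (G : N →ₗ[k] N') (F' : M →ₗ[k] M') (hB : N →ₗ[k] N')
    {j : ℤ} {m : M} (hm : m ∈ gm j) (n : N) :
    tenHt gm hA G F' hB (m ⊗ₜ n) = hA m ⊗ₜ G n + sgnz j • (F' m ⊗ₜ hB n) := by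
  simp [tenHt, sg_apply gm hm, TensorProduct.smul_tmul']

theorem tenHt_deg {hA : M →ₗ[k] M'} {G : N →ₗ[k] N'} {F' : M →ₗ[k] M'} {hB : N →ₗ[k] N'}
    (Ad : ∀ j, ∀ x ∈ gm j, hA x ∈ gm' (j - 1)) (Gd : ∀ j, ∀ x ∈ gn j, G x ∈ gn' j)
    (Fd : ∀ j, ∀ x ∈ gm j, F' x ∈ gm' j) (Bd : ∀ j, ∀ x ∈ gn j, hB x ∈ gn' (j - 1))
    (j : ℤ) (t : M ⊗[k] N) (ht : t ∈ tenGrade gm gn j) :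
    tenHt gm hA G F' hB t ∈ tenGrade gm' gn' (j - 1) := by
  refine tengr_ind gm gn (p := fun t => tenHt gm hA G F' hB t ∈ tenGrade gm' gn' (j - 1)) ?_
    (fun x y hx hy => by rw [map_add]; exact Submodule.add_mem _ hx hy) ht
  rintro p q rfl m hm n hn
  rw [tenHt_apply gm _ _ _ _ hm]
  exact Submodule.add_mem _ (mem_ten (Ad _ _ hm) (Gd _ _ hn) (by ring))
    (zsmul_mem (mem_ten (Fd _ _ hm) (Bd _ _ hn) (by ring)) _)

theorem tenHt_spec {F F' hA : M →ₗ[k] M'} {G G' hB : N →ₗ[k] N'}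
    (d1 : ∀ j, ∀ x ∈ gm j, D₁ x ∈ gm (j + 1))
    (Ad : ∀ j, ∀ x ∈ gm j, hA x ∈ gm' (j - 1))
    (Fd : ∀ j, ∀ x ∈ gm j, F' x ∈ gm' j)
    (hF : ∀ x, F' (D₁ x) = D₁' (F' x)) (hG : ∀ x, G (D₂ x) = D₂' (G x))
    (hhA : ∀ x, F x - F' x = D₁' (hA x) + hA (D₁ x))
    (hhB : ∀ x, G x - G' x = D₂' (hB x) + hB (D₂ x)) (t : M ⊗[k] N) :
    TensorProduct.map F G t - TensorProduct.map F' G' t =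
      tD gm' D₁' D₂' (tenHt gm hA G F' hB t) + tenHt gm hA G F' hB (tD gm D₁ D₂ t) := by
  induction t with
  | zero => simp
  | add x y hx hy => simp only [map_add, add_sub_add_comm, hx, hy]; abel
  | tmul m n =>
    refine hom_ind gm (p := fun m => TensorProduct.map F G (m ⊗ₜ n) - TensorProduct.map F' G' (m ⊗ₜ n) =
      tD gm' D₁' D₂' (tenHt gm hA G F' hB (m ⊗ₜ n)) + tenHt gm hA G F' hB (tD gm D₁ D₂ (m ⊗ₜ n)))
      (fun j m hm => ?_) (fun x y hx hy => by
        simp only [TensorProduct.add_tmul, map_add, add_sub_add_comm, hx, hy]; abel) m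
    rw [tD_apply gm _ _ hm, tenHt_apply gm _ _ _ _ hm, map_add, map_add, map_zsmul, map_zsmul,
      tD_apply gm' _ _ (Ad _ _ hm), tD_apply gm' _ _ (Fd _ _ hm), tenHt_apply gm _ _ _ _ hm,
      tenHt_apply gm _ _ _ _ (d1 _ _ hm), hF, hG]
    have e1 : F m = F' m + (D₁' (hA m) + hA (D₁ m)) := by rw [← hhA]; abel
    have e2 : G' n = G n - (D₂' (hB n) + hB (D₂ n)) := by rw [← hhB]; abel
    simp only [TensorProduct.map_tmul, e1, e2, TensorProduct.add_tmul, TensorProduct.tmul_add,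
      TensorProduct.tmul_sub, smul_add, sgnz_add, sub_eq_add_neg j 1,
      show sgnz 1 = -1 from sgnz_odd (by decide), show sgnz (-1) = -1 from sgnz_odd (by decide)]
    rcases sgnz_cases j with h | h <;> rw [h] <;> module

/-- Künneth -/
theorem kunneth (h1 : ∀ x, D₁ (D₁ x) = 0) (h2 : ∀ x, D₂ (D₂ x) = 0)
    (h1' : ∀ x, D₁' (D₁' x) = 0) (h2' : ∀ x, D₂' (D₂' x) = 0)
    (d1 : ∀ j, ∀ x ∈ gm j, D₁ x ∈ gm (j + 1)) (d2 : ∀ j, ∀ x ∈ gn j, D₂ x ∈ gn (j + 1))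
    (d1' : ∀ j, ∀ x ∈ gm' j, D₁' x ∈ gm' (j + 1)) (d2' : ∀ j, ∀ x ∈ gn' j, D₂' x ∈ gn' (j + 1))
    {F : M →ₗ[k] M'} {G : N →ₗ[k] N'}
    (Fd : ∀ j, ∀ x ∈ gm j, F x ∈ gm' j) (Gd : ∀ j, ∀ x ∈ gn j, G x ∈ gn' j)
    (hF : ∀ x, F (D₁ x) = D₁' (F x)) (hG : ∀ x, G (D₂ x) = D₂' (G x))
    (qF : QIsoData gm D₁ gm' D₁' F) (qG : QIsoData gn D₂ gn' D₂' G) :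
    QIsoData (tenGrade gm gn) (tD gm D₁ D₂) (tenGrade gm' gn') (tD gm' D₁' D₂')
      (TensorProduct.map F G) := by
  obtain ⟨f, u, v, fd, ud, vd, hf, hu, hv⟩ := gr_hoinv gm gm' h1 h1' d1 d1' F hF Fd qF
  obtain ⟨g, w, z, gd, wd, zd, hg, hw, hz⟩ := gr_hoinv gn gn' h2 h2' d2 d2' G hG Gd qG
  refine qiso_of_hoequiv (gm := tenGrade gm gn) (gn := tenGrade gm' gn') (TensorProduct.map F G)
    (map_tD gm gm' Fd hF hG) (by simpa using map_deg gm gn gm' gn' 0 0 (by simpa using Fd) (by simpa using Gd))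
    (TensorProduct.map f g) (tenHt gm u (g ∘ₗ G) LinearMap.id w)
    (tenHt gm' v (G ∘ₗ g) LinearMap.id z)
    (by simpa using map_deg gm' gn' gm gn 0 0 (by simpa using fd) (by simpa using gd))
    (map_tD gm' gm fd hf hg) ?_ ?_
  · intro t
    have := tenHt_spec (D₂ := D₂) (D₂' := D₂) (D₁ := D₁) (D₁' := D₁) (F := f ∘ₗ F)
      (F' := LinearMap.id) (hA := u) (G := g ∘ₗ G) (G' := LinearMap.id) (hB := w) gm gm
      d1 ud (fun _ _ h => h) (fun _ => rfl) (fun x => by simp [hG, hg]) hu hw t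
    rw [← this]; simp [TensorProduct.map_comp]
  · intro t
    have := tenHt_spec (D₂ := D₂') (D₂' := D₂') (D₁ := D₁') (D₁' := D₁') (F := F ∘ₗ f)
      (F' := LinearMap.id) (hA := v) (G := G ∘ₗ g) (G' := LinearMap.id) (hB := z) gm' gm'
      d1' vd (fun _ _ h => h) (fun _ => rfl) (fun x => by simp [hG, hg]) hv hz t
    rw [← this]; simp [TensorProduct.map_comp]

end tenh

set_option linter.unusedSimpArgs false

section sact
variable {R M N : Type} [AddCommGroup R] [Module k R] [AddCommGroup M] [Module k M]
  (gr : ℤ → Submodule k R) [DirectSum.Decomposition gr]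
  (gm : ℤ → Submodule k M) [DirectSum.Decomposition gm]

/-- even and odd part projections -/
def pe : M →ₗ[k] M := gop gm (fun j => if Even j then 1 else 0)
def po : M →ₗ[k] M := gop gm (fun j => if Even j then 0 else 1)
theorem pe_apply {j : ℤ} {m : M} (hm : m ∈ gm j) : pe gm m = if Even j then m else 0 := by
  rw [pe, gop_apply gm _ hm]; split_ifs <;> simp
theorem po_apply {j : ℤ} {m : M} (hm : m ∈ gm j) : po gm m = if Even j then 0 else m := by
  rw [po, gop_apply gm _ hm]; split_ifs <;> simp

/-- action twisted by the Koszul sign -/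
def sact (act : R →ₗ[k] M →ₗ[k] M) : R →ₗ[k] M →ₗ[k] M :=
  act ∘ₗ pe gr + (act ∘ₗ po gr).compl₂ (sg gm)

theorem sact_apply (act : R →ₗ[k] M →ₗ[k] M) {i j : ℤ} {a : R} {m : M} (ha : a ∈ gr i)
    (hm : m ∈ gm j) : sact gr gm act a m = sgnz (i * j) • act a m := by
  simp only [sact, LinearMap.add_apply, LinearMap.comp_apply, LinearMap.compl₂_apply,
    pe_apply gr ha, po_apply gr ha, sg_apply gm hm]
  split_ifs with h
  · simp [sgnz_even (h.mul_right j)]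
  · simp [map_zsmul, sgnz, Int.even_mul, h, -ite_smul, -smul_ite]

/-- Koszul sign operator on a tensor product -/
def kz [AddCommGroup N] [Module k N] (gn : ℤ → Submodule k N) [DirectSum.Decomposition gn] :
    (M ⊗[k] N) →ₗ[k] (M ⊗[k] N) :=
  TensorProduct.map (pe gm) LinearMap.id + TensorProduct.map (po gm) (sg gn)

theorem kz_apply [AddCommGroup N] [Module k N] (gn : ℤ → Submodule k N)
    [DirectSum.Decomposition gn] {i j : ℤ} {m : M} {n : N} (hm : m ∈ gm i) (hn : n ∈ gn j) :
    kz gm gn (m ⊗ₜ n) = sgnz (i * j) • (m ⊗ₜ n) := by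
  simp only [kz, LinearMap.add_apply, TensorProduct.map_tmul, pe_apply gm hm, po_apply gm hm,
    sg_apply gn hn, LinearMap.id_apply, tmul_zs]
  split_ifs with h
  · simp [sgnz_even (h.mul_right j)]
  · simp [sgnz, Int.even_mul, h]

theorem kz_kz [AddCommGroup N] [Module k N] (gn : ℤ → Submodule k N)
    [DirectSum.Decomposition gn] (t : M ⊗[k] N) : kz gm gn (kz gm gn t) = t := by
  refine ten_ind gm gn (p := fun t => kz gm gn (kz gm gn t) = t) (fun i j m hm n hn => ?_)
    (fun x y hx hy => by simp only [map_add, hx, hy]) t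
  rw [kz_apply gm gn hm hn, map_zsmul, kz_apply gm gn hm hn, sgnz_smul_smul]

end sact

theorem biact_apply {A : DGAlgebra k} (N : DGBimod A) {i j : ℤ} {x y : A.R} {m : N.M}
    (hx : x ∈ A.gr i) (hm : m ∈ N.gm j) :
    biact N (x ⊗ₜ y) m = sgnz (i * j) • N.actL x (N.actR y m) := by
  have h : DirectSum.decomposeLinearEquiv A.gr x =
      DirectSum.lof k ℤ (fun i => A.gr i) i ⟨x, hx⟩ := DirectSum.decompose_of_mem A.gr hx
  simp only [biact, TensorProduct.lift.tmul, LinearMap.comp_apply, LinearEquiv.coe_coe, h,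
    DirectSum.toModule_lof]
  simp [biactAux, gop_apply N.gm _ hm, sgnk_smul]

/-- data of an opposite algebra -/
structure OpD (A A' : DGAlgebra k) where
  φ : A.R ≃ₗ[k] A'.R
  one : φ 1 = 1
  mul : ∀ (i j : ℤ) (x y : A.R), x ∈ A.gr i → y ∈ A.gr j →
      φ (x * y) = sgnz (i * j) • (φ y * φ x)
  deg : ∀ (i : ℤ), ∀ x ∈ A.gr i, φ x ∈ A'.gr i
  d : ∀ x : A.R, φ (A.d x) = A'.d (φ x)

section op
variable {A A' : DGAlgebra k} (o : OpD A A')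

theorem OpD.mul' {i j : ℤ} {x y : A.R} (hx : x ∈ A.gr i) (hy : y ∈ A.gr j) :
    o.φ y * o.φ x = sgnz (i * j) • o.φ (x * y) := by
  rw [o.mul i j x y hx hy, sgnz_smul_smul]

theorem OpD.deg' {i : ℤ} {x : A.R} (hx : o.φ x ∈ A'.gr i) : x ∈ A.gr i :=
  equiv_gr o.φ o.deg i x hx

def opL (X : DGBimod A) : A'.R →ₗ[k] X.M →ₗ[k] X.M :=
  sact A.gr X.gm X.actR ∘ₗ o.φ.symm.toLinearMap
def opR (X : DGBimod A) : A'.R →ₗ[k] X.M →ₗ[k] X.M :=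
  sact A.gr X.gm X.actL ∘ₗ o.φ.symm.toLinearMap

variable (X : DGBimod A)

theorem opL_apply {i j : ℤ} {a : A.R} {m : X.M} (ha : a ∈ A.gr i) (hm : m ∈ X.gm j) :
    opL o X (o.φ a) m = sgnz (i * j) • X.actR a m := by
  simp [opL, sact_apply A.gr X.gm _ ha hm]
theorem opR_apply {i j : ℤ} {a : A.R} {m : X.M} (ha : a ∈ A.gr i) (hm : m ∈ X.gm j) :
    opR o X (o.φ a) m = sgnz (i * j) • X.actL a m := by
  simp [opR, sact_apply A.gr X.gm _ ha hm]

theorem op_ind {p : A'.R → Prop} (h : ∀ i, ∀ a ∈ A.gr i, p (o.φ a))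
    (ha : ∀ x y, p x → p y → p (x + y)) (x : A'.R) : p x := by
  obtain ⟨a, rfl⟩ := o.φ.surjective x
  exact hom_ind A.gr (p := fun a => p (o.φ a)) h
    (fun x y hx hy => by rw [map_add]; exact ha _ _ hx hy) a

def opB : DGBimod A' where
  M := X.M
  gm := X.gm
  actL := opL o X
  actR := opR o X
  actL_one := by
    refine hom_ind X.gm (fun j m hm => ?_) (fun x y hx hy => by rw [map_add, hx, hy])
    rw [← o.one, opL_apply o X A.one_mem hm, X.actR_one]; simp [sgnz]
  actR_one := by
    refine hom_ind X.gm (fun j m hm => ?_) (fun x y hx hy => by rw [map_add, hx, hy])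
    rw [← o.one, opR_apply o X A.one_mem hm, X.actL_one]; simp [sgnz]
  actL_mul := fun x y m => by
    revert x
    refine op_ind o ?_ (fun x y hx hy => by simp only [add_mul, map_add, LinearMap.add_apply, hx, hy])
    intro i a ha
    revert y
    refine op_ind o ?_ (fun x y hx hy => by simp only [mul_add, map_add, LinearMap.add_apply, hx, hy])
    intro j b hb
    revert m
    refine hom_ind X.gm (fun p m hm => ?_) (fun x y hx hy => by simp only [map_add, hx, hy])
    rw [o.mul' hb ha, map_zsmul, LinearMap.smul_apply, opL_apply o X (A.mul_mem hb ha) hm,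
      opL_apply o X hb hm, map_zsmul, opL_apply o X ha (X.actR_deg _ _ _ _ hb hm), X.actR_mul,
      smul_smul, smul_smul]
    congr 1
    simp only [sgnz, Int.even_add, Int.even_mul, Int.even_sub, Int.not_even_one]; grind
  actR_mul := fun x y m => by
    revert x
    refine op_ind o ?_ (fun x y hx hy => by simp only [add_mul, map_add, LinearMap.add_apply, hx, hy])
    intro i a ha
    revert y
    refine op_ind o ?_ (fun x y hx hy => by simp only [mul_add, map_add, LinearMap.add_apply, hx, hy])
    intro j b hb
    revert m
    refine hom_ind X.gm (fun p m hm => ?_) (fun x y hx hy => by simp only [map_add, hx, hy])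
    rw [o.mul' hb ha, map_zsmul, LinearMap.smul_apply, opR_apply o X (A.mul_mem hb ha) hm,
      opR_apply o X ha hm, map_zsmul, opR_apply o X hb (X.actL_deg _ _ _ _ ha hm), X.actL_mul,
      smul_smul, smul_smul]
    congr 1
    simp only [sgnz, Int.even_add, Int.even_mul, Int.even_sub, Int.not_even_one]; grind
  actLR := fun x y m => by
    revert x
    refine op_ind o ?_ (fun x y hx hy => by simp only [map_add, LinearMap.add_apply, hx, hy])
    intro i a ha
    revert y
    refine op_ind o ?_ (fun x y hx hy => by simp only [map_add, LinearMap.add_apply, hx, hy])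
    intro j b hb
    revert m
    refine hom_ind X.gm (fun p m hm => ?_) (fun x y hx hy => by simp only [map_add, hx, hy])
    rw [opR_apply o X hb hm, opL_apply o X ha hm, map_zsmul, map_zsmul,
      opL_apply o X ha (X.actL_deg _ _ _ _ hb hm), opR_apply o X hb (X.actR_deg _ _ _ _ ha hm),
      X.actLR, smul_smul, smul_smul]
    congr 1
    simp only [sgnz, Int.even_add, Int.even_mul, Int.even_sub, Int.not_even_one]; grind
  actL_deg := fun i j x m hx hm => by
    obtain ⟨a, rfl⟩ := o.φ.surjective x
    have ha := o.deg' hx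
    rw [opL_apply o X ha hm, add_comm]
    exact zsmul_mem (X.actR_deg _ _ _ _ ha hm) _
  actR_deg := fun i j x m hx hm => by
    obtain ⟨a, rfl⟩ := o.φ.surjective x
    have ha := o.deg' hx
    rw [opR_apply o X ha hm, add_comm]
    exact zsmul_mem (X.actL_deg _ _ _ _ ha hm) _
  D := X.D
  D_deg := X.D_deg
  D_sq := X.D_sq
  leibnizL := fun i j x m hx hm => by
    obtain ⟨a, rfl⟩ := o.φ.surjective x
    have ha := o.deg' hx
    rw [← o.d, opL_apply o X ha hm, opL_apply o X (A.d_deg _ _ ha) hm,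
      opL_apply o X ha (X.D_deg _ _ hm), map_zsmul, X.leibnizR i j a m ha hm]
    match_scalars <;> simp only [sgnz, Int.even_add, Int.even_mul, Int.even_sub, Int.not_even_one] <;> grind
  leibnizR := fun i j x m hx hm => by
    obtain ⟨a, rfl⟩ := o.φ.surjective x
    have ha := o.deg' hx
    rw [← o.d, opR_apply o X ha hm, opR_apply o X (A.d_deg _ _ ha) hm,
      opR_apply o X ha (X.D_deg _ _ hm), map_zsmul, X.leibnizL i j a m ha hm]
    match_scalars <;> simp only [sgnz, Int.even_add, Int.even_mul, Int.even_sub, Int.not_even_one] <;> grind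

theorem op_lin {X Y : DGBimod A} (F : X.M →ₗ[k] Y.M) (d : ℤ)
    (Fd : ∀ j, ∀ m ∈ X.gm j, F m ∈ Y.gm (j + d))
    (hL : ∀ (i : ℤ) (x : A.R), x ∈ A.gr i → ∀ m : X.M, F (X.actL x m) = sgnz (i * d) • Y.actL x (F m))
    (hR : ∀ (x : A.R) (m : X.M), F (X.actR x m) = Y.actR x (F m)) :
    (∀ (i : ℤ) (x : A'.R), x ∈ A'.gr i → ∀ m : X.M, F (opL o X x m) =
      sgnz (i * d) • opL o Y x (F m)) ∧
    (∀ (x : A'.R) (m : X.M), F (opR o X x m) = opR o Y x (F m)) := by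
  constructor
  · intro i x hx
    obtain ⟨a, rfl⟩ := o.φ.surjective x
    have ha := o.deg' hx
    refine hom_ind X.gm (fun p m hm => ?_) (fun x y hx hy => by
      simp only [map_add, hx, hy, smul_add])
    rw [opL_apply o X ha hm, opL_apply o Y ha (Fd _ _ hm), map_zsmul, hR, smul_smul]
    congr 1
    simp only [sgnz, Int.even_add, Int.even_mul, Int.even_sub, Int.not_even_one]; grind
  · intro x m
    revert x
    refine op_ind o ?_ (fun x y hx hy => by simp only [map_add, LinearMap.add_apply, hx, hy])
    intro i a ha
    revert m
    refine hom_ind X.gm (fun p m hm => ?_) (fun x y hx hy => by simp only [map_add, hx, hy])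
    rw [opR_apply o X ha hm, opR_apply o Y ha (Fd _ _ hm), map_zsmul, hL i a ha, smul_smul]
    congr 1
    simp only [sgnz, Int.even_add, Int.even_mul, Int.even_sub, Int.not_even_one]; grind

theorem lin_of_hom {B : DGAlgebra k} {V : Type} [AddCommGroup V] {p q : B.R → V}
    (hp : ∀ x y, p (x + y) = p x + p y) (hq : ∀ x y, q (x + y) = q x + q y)
    (h : ∀ (i : ℤ) (x : B.R), x ∈ B.gr i → p x = sgnz (i * 0) • q x) (x : B.R) : p x = q x := by
  refine hom_ind B.gr (p := fun x => p x = q x) (fun i x hx => ?_)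
    (fun x y hx hy => by rw [hp, hq, hx, hy]) x
  rw [h i x hx]; simp [sgnz]

def opHom {X Y : DGBimod A} (F : BimodHom X Y) : BimodHom (opB o X) (opB o Y) where
  f := F.f
  deg := F.deg
  comm := F.comm
  actLc := fun x m => by
    refine lin_of_hom (p := fun x => F.f (opL o X x m)) (q := fun x => opL o Y x (F.f m))
      (by intro x y; simp only [map_add]; exact map_add F.f _ _) (by intro x y; simp) (fun i x hx => ?_) x
    exact (op_lin o F.f 0 (by simpa using F.deg)
      (by intro i x hx m; rw [F.actLc]; simp [sgnz]) F.actRc).1 i x hx m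
  actRc := (op_lin o F.f 0 (by simpa using F.deg)
      (by intro i x hx m; rw [F.actLc]; simp [sgnz]) F.actRc).2

theorem op_homotopic {X Y : DGBimod A} {F G : BimodHom X Y} (F' G' : BimodHom (opB o X) (opB o Y))
    (hF' : F'.f = F.f) (hG' : G'.f = G.f) (h : BimodHomotopic F G) : BimodHomotopic F' G' := by
  obtain ⟨h, h1, h2, h3, h4⟩ := h
  have e : ∀ i : ℤ, sgnz (i * (-1)) = sgnz i := by
    intro i; simp [sgnz]
  have := op_lin o h (-1) h1 (by intro i x hx m; rw [e, h2 i x hx]) h3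
  refine ⟨h, h1, ?_, this.2, fun m => by rw [hF', hG']; exact h4 m⟩
  intro i x hx m
  have h5 := this.1 i x hx m
  rw [e] at h5
  exact h5

theorem op_hosummand {P T : DGBimod A} (h : IsHoSummandB P T) : IsHoSummandB (opB o P) (opB o T) := by
  obtain ⟨ι, ρ, h⟩ := h
  exact ⟨opHom o ι, opHom o ρ, op_homotopic o _ _ rfl rfl h⟩

theorem op_biSpan (S : Set X.M) (hSh : ∀ m ∈ S, ∃ j, m ∈ X.gm j) :
    (biSpan X S : Submodule k X.M) ≤ (biSpan (opB o X) S : Submodule k X.M) := by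
  refine le_sInf ?_
  intro p hp
  change Submodule k X.M at p
  have hS : S ⊆ (p : Set X.M) := hp.1
  have hL : ∀ (x : A'.R) (m : X.M), m ∈ p → opL o X x m ∈ p := hp.2.1
  have hR : ∀ (x : A'.R) (m : X.M), m ∈ p → opR o X x m ∈ p := hp.2.2
  let q : Submodule k X.M := ⨅ j, p.comap (prj X.gm j)
  have hq : ∀ m, m ∈ q ↔ ∀ j, prj X.gm j m ∈ p := by
    intro m; simp [q, Submodule.mem_iInf]
  have hqp : q ≤ p := by
    intro m hm
    obtain ⟨s, hs⟩ := prj_sum X.gm m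
    rw [hs]
    exact Submodule.sum_mem _ (fun j _ => (hq m).1 hm j)
  refine le_trans (sInf_le ⟨?_, ?_, ?_⟩) hqp
  · intro m hm
    obtain ⟨i, hi⟩ := hSh m hm
    refine (hq m).2 (fun j => ?_)
    by_cases h : i = j
    · subst h; rw [prj_same X.gm hi]; exact hS hm
    · rw [prj_ne X.gm hi h]; exact p.zero_mem
  · intro x m hm
    refine hom_ind A.gr (p := fun x => X.actL x m ∈ q) (fun i a ha => ?_)
      (fun x y hx hy => by rw [map_add]; exact q.add_mem hx hy) x
    refine (hq _).2 (fun j => ?_)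
    have h1 := prj_comm X.gm X.gm (X.actL a) i
      (fun j m hm => by rw [add_comm]; exact X.actL_deg _ _ _ _ ha hm) (j - i) m
    rw [sub_add_cancel] at h1
    have h2 := opR_apply o X ha (prj_mem X.gm (j - i) m)
    have h3 := hR (o.φ a) _ ((hq m).1 hm (j - i))
    rw [h2] at h3
    rw [h1, ← sgnz_smul_smul (i * (j - i)) (X.actL a _)]
    exact zsmul_mem h3 _
  · intro x m hm
    refine hom_ind A.gr (p := fun x => X.actR x m ∈ q) (fun i a ha => ?_)
      (fun x y hx hy => by rw [map_add]; exact q.add_mem hx hy) x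
    refine (hq _).2 (fun j => ?_)
    have h1 := prj_comm X.gm X.gm (X.actR a) i
      (fun j m hm => X.actR_deg _ _ _ _ ha hm) (j - i) m
    rw [sub_add_cancel] at h1
    have h2 := opL_apply o X ha (prj_mem X.gm (j - i) m)
    have h3 := hL (o.φ a) _ ((hq m).1 hm (j - i))
    rw [h2] at h3
    rw [h1, ← sgnz_smul_smul (i * (j - i)) (X.actR a _)]
    exact zsmul_mem h3 _

/-- comparison equivalence for the opposite enveloping algebra -/
def opW : (A'.R ⊗[k] A'.R) ≃ₗ[k] (A.R ⊗[k] A.R) :=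
  ((TensorProduct.congr o.φ.symm o.φ.symm) ≪≫ₗ
    (LinearEquiv.ofLinear (kz A.gr A.gr) (kz A.gr A.gr)
      (LinearMap.ext (kz_kz A.gr A.gr)) (LinearMap.ext (kz_kz A.gr A.gr)))) ≪≫ₗ
    TensorProduct.comm k A.R A.R

theorem op_biact {j : ℤ} {m : X.M} (hm : m ∈ X.gm j) (u : A'.R ⊗[k] A'.R) :
    biact (opB o X) u m = biact X (opW o u) m := by
  obtain ⟨v, rfl⟩ := (TensorProduct.congr o.φ o.φ).surjective u
  refine ten_ind A.gr A.gr (p := fun v => biact (opB o X) (TensorProduct.congr o.φ o.φ v) m =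
    biact X (opW o (TensorProduct.congr o.φ o.φ v)) m) (fun p q a ha b hb => ?_)
    (fun x y hx hy => by
      simp only [map_add, LinearMap.add_apply]
      exact congrArg₂ (· + ·) hx hy) v
  rw [TensorProduct.congr_tmul]
  have e : opW o (o.φ a ⊗ₜ o.φ b) = sgnz (p * q) • (b ⊗ₜ a) := by
    simp only [opW, LinearEquiv.trans_apply, TensorProduct.congr_tmul,
      LinearEquiv.symm_apply_apply, LinearEquiv.ofLinear_apply, kz_apply A.gr A.gr ha hb,
      map_zsmul, TensorProduct.comm_tmul]
  rw [e]
  refine (biact_apply (opB o X) (o.deg _ _ ha) hm).trans ?_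
  rw [map_zsmul, LinearMap.smul_apply, biact_apply X hb hm]
  change sgnz (p * j) • opL o X (o.φ a) (opR o X (o.φ b) m) = _
  rw [opR_apply o X hb hm, map_zsmul, opL_apply o X ha (X.actL_deg _ _ _ _ hb hm), X.actLR]
  simp only [smul_smul]
  congr 1
  simp only [sgnz, Int.even_add, Int.even_mul, Int.even_sub, Int.not_even_one]; grind

theorem op_twisted {T : DGBimod A} (h : IsTwistedB T) : IsTwistedB (opB o T) := by
  obtain ⟨s, r, e, h1, h2, h3⟩ := h
  refine ⟨s, r, e, h1, fun j => op_biSpan o T _ ?_ (h2 j), ?_⟩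
  · rintro _ ⟨i, _, rfl⟩
    exact ⟨_, h1 i⟩
  · have := h3.comp (LinearEquiv.piCongrRight (fun _ : Fin s => opW o)).bijective
    have e' : (fun v : Fin s → A'.R ⊗[k] A'.R => ∑ j, biact (opB o T) (v j) (e j)) =
        (fun v : Fin s → A.R ⊗[k] A.R => ∑ j, biact T (v j) (e j)) ∘
        (LinearEquiv.piCongrRight (fun _ : Fin s => opW o)) :=
      funext fun v => Finset.sum_congr rfl (fun j _ => op_biact o T (h1 j) (v j))
    exact e'.symm ▸ this

theorem op_smooth (o : OpD A A') (hA : IsSmooth A) : IsSmooth A' := by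
  obtain ⟨T, P, hT, hP, F, hF⟩ := hA
  let G : BimodHom (opB o P) (diagBimod A') :=
    { f := o.φ.toLinearMap ∘ₗ F.f
      deg := fun j m hm => o.deg _ _ (F.deg j m hm)
      comm := fun m => by
        have := F.comm m
        exact (congrArg o.φ this).trans (o.d _)
      actLc := fun x m => by
        refine ((congrArg o.φ ((opHom o F).actLc x m))).trans ?_
        change o.φ (opL o (diagBimod A) x (F.f m)) = x * o.φ (F.f m)
        generalize F.f m = n
        change A.R at n
        revert x
        refine op_ind o ?_ (fun x y hx hy => by
          simp only [map_add, LinearMap.add_apply, hx, hy, add_mul]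
          exact (map_add o.φ _ _).trans (congrArg₂ _ hx hy))
        intro i a ha
        revert n
        refine hom_ind A.gr (fun p m hm => ?_) (fun x y hx hy => by
          rw [map_add, mul_add, ← hx, ← hy]
          exact (congrArg o.φ (map_add _ _ _)).trans (map_add o.φ _ _))
        refine (congrArg o.φ (opL_apply o (diagBimod A) ha hm)).trans ?_
        rw [o.mul' hm ha, mul_comm i p]
        exact map_zsmul o.φ (sgnz (p * i)) (m * a)
      actRc := fun x m => by
        refine ((congrArg o.φ ((opHom o F).actRc x m))).trans ?_
        change o.φ (opR o (diagBimod A) x (F.f m)) = o.φ (F.f m) * x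
        generalize F.f m = n
        change A.R at n
        revert x
        refine op_ind o ?_ (fun x y hx hy => by
          simp only [map_add, LinearMap.add_apply, hx, hy, mul_add]
          exact (map_add o.φ _ _).trans (congrArg₂ _ hx hy))
        intro i a ha
        revert n
        refine hom_ind A.gr (fun p m hm => ?_) (fun x y hx hy => by
          rw [map_add, add_mul, ← hx, ← hy]
          exact (congrArg o.φ (map_add _ _ _)).trans (map_add o.φ _ _))
        refine (congrArg o.φ (opR_apply o (diagBimod A) ha hm)).trans ?_
        rw [o.mul' ha hm]
        exact map_zsmul o.φ (sgnz (i * p)) (a * m) }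
  refine ⟨opB o T, opB o P, op_twisted o hT, op_hosummand o hP, G, ?_⟩
  exact qiso_comp_equiv (gx := A'.gr) hF o.φ o.deg (fun j x hx => o.deg' hx) o.d

end op


/-- tensor product data -/
structure TD (A B C : DGAlgebra k) where
  iA : A.R →ₗ[k] C.R
  iB : B.R →ₗ[k] C.R
  oneA : iA 1 = 1
  oneB : iB 1 = 1
  mulA : ∀ x y : A.R, iA (x * y) = iA x * iA y
  mulB : ∀ x y : B.R, iB (x * y) = iB x * iB y
  degA : ∀ (i : ℤ), ∀ x ∈ A.gr i, iA x ∈ C.gr i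
  degB : ∀ (j : ℤ), ∀ y ∈ B.gr j, iB y ∈ C.gr j
  cm : ∀ (i j : ℤ) (x : A.R) (y : B.R), x ∈ A.gr i → y ∈ B.gr j →
      iB y * iA x = sgnz (i * j) • (iA x * iB y)
  dA : ∀ x : A.R, C.d (iA x) = iA (A.d x)
  dB : ∀ y : B.R, C.d (iB y) = iB (B.d y)
  Φ : (A.R ⊗[k] B.R) ≃ₗ[k] C.R
  hΦ : ∀ x y, Φ (x ⊗ₜ y) = iA x * iB y

namespace TD
variable {A B C : DGAlgebra k} (t : TD A B C)

theorem mulΦ {p q : ℤ} (a : A.R) {a' : A.R} {b : B.R} (b' : B.R) (hb : b ∈ B.gr q)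
    (ha : a' ∈ A.gr p) :
    t.Φ (a ⊗ₜ b) * t.Φ (a' ⊗ₜ b') = sgnz (q * p) • t.Φ ((a * a') ⊗ₜ (b * b')) := by
  rw [t.hΦ, t.hΦ, t.hΦ, t.mulA, t.mulB, mul_assoc, ← mul_assoc (t.iB b), t.cm p q a' b ha hb,
    smul_mul_assoc, mul_smul_comm, mul_comm p q]
  simp only [mul_assoc]

theorem dΦ {p : ℤ} {a : A.R} (b : B.R) (ha : a ∈ A.gr p) :
    C.d (t.Φ (a ⊗ₜ b)) = t.Φ (A.d a ⊗ₜ b) + sgnz p • t.Φ (a ⊗ₜ B.d b) := by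
  rw [t.hΦ, t.hΦ, t.hΦ, C.leibniz p _ (t.degA p a ha), t.dA, t.dB]

theorem oneΦ : t.Φ (1 ⊗ₜ 1) = 1 := by rw [t.hΦ, t.oneA, t.oneB, one_mul]

theorem degΦ' {p q n : ℤ} {a : A.R} {b : B.R} (ha : a ∈ A.gr p) (hb : b ∈ B.gr q)
    (h : p + q = n) : t.Φ (a ⊗ₜ b) ∈ C.gr n := by
  rw [t.hΦ, ← h]; exact C.mul_mem (t.degA _ _ ha) (t.degB _ _ hb)

theorem degΦ (j : ℤ) (x : A.R ⊗[k] B.R) (hx : x ∈ tenGrade A.gr B.gr j) : t.Φ x ∈ C.gr j := by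
  refine tengr_ind A.gr B.gr (p := fun x => t.Φ x ∈ C.gr j) ?_
    (fun x y hx hy => by rw [map_add]; exact Submodule.add_mem _ hx hy) hx
  intro p q h m hm n hn
  exact t.degΦ' hm hn h

theorem ind {p : C.R → Prop}
    (h : ∀ i j, ∀ a ∈ A.gr i, ∀ b ∈ B.gr j, p (t.Φ (a ⊗ₜ b)))
    (ha : ∀ x y, p x → p y → p (x + y)) (c : C.R) : p c := by
  obtain ⟨x, rfl⟩ := t.Φ.surjective c
  exact ten_ind A.gr B.gr (p := fun x => p (t.Φ x)) h
    (fun x y hx hy => by rw [map_add]; exact ha _ _ hx hy) x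

theorem gr_ind {p : C.R → Prop} {n : ℤ}
    (h : ∀ i j, i + j = n → ∀ a ∈ A.gr i, ∀ b ∈ B.gr j, p (t.Φ (a ⊗ₜ b)))
    (ha : ∀ x y, p x → p y → p (x + y)) (c : C.R) (hc : c ∈ C.gr n) : p c := by
  obtain ⟨x, rfl⟩ := t.Φ.surjective c
  have hx := equiv_gr (gm := tenGrade A.gr B.gr) (gn := C.gr) t.Φ t.degΦ n x hc
  exact tengr_ind A.gr B.gr (p := fun x => p (t.Φ x)) h
    (fun x y hx hy => by rw [map_add]; exact ha _ _ hx hy) hx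

variable (X : DGBimod A) (Y : DGBimod B)

def aL : C.R →ₗ[k] (X.M ⊗[k] Y.M) →ₗ[k] (X.M ⊗[k] Y.M) :=
  TensorProduct.lift
    ((TensorProduct.mapBilinear (RingHom.id k) X.M Y.M X.M Y.M ∘ₗ X.actL).compl₂ (Y.actL ∘ₗ pe B.gr) +
     (TensorProduct.mapBilinear (RingHom.id k) X.M Y.M X.M Y.M ∘ₗ X.actL.compl₂ (sg X.gm)).compl₂
        (Y.actL ∘ₗ po B.gr)) ∘ₗ t.Φ.symm.toLinearMap

def aR : C.R →ₗ[k] (X.M ⊗[k] Y.M) →ₗ[k] (X.M ⊗[k] Y.M) :=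
  TensorProduct.lift
    ((TensorProduct.mapBilinear (RingHom.id k) X.M Y.M X.M Y.M ∘ₗ X.actR ∘ₗ pe A.gr).compl₂ Y.actR +
     (TensorProduct.mapBilinear (RingHom.id k) X.M Y.M X.M Y.M ∘ₗ X.actR ∘ₗ po A.gr).compl₂
        (Y.actR.compl₂ (sg Y.gm))) ∘ₗ t.Φ.symm.toLinearMap

theorem aL_apply {p q : ℤ} (a : A.R) {b : B.R} (hb : b ∈ B.gr q) {m : X.M} (hm : m ∈ X.gm p)
    (n : Y.M) : t.aL X Y (t.Φ (a ⊗ₜ b)) (m ⊗ₜ n) = sgnz (q * p) • (X.actL a m ⊗ₜ Y.actL b n) := by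
  simp only [aL, LinearMap.comp_apply, LinearEquiv.coe_coe, LinearEquiv.symm_apply_apply,
    TensorProduct.lift.tmul, LinearMap.add_apply, LinearMap.compl₂_apply,
    TensorProduct.mapBilinear_apply, TensorProduct.map_tmul, sg_apply X.gm hm,
    pe_apply B.gr hb, po_apply B.gr hb]
  split_ifs with h
  · simp [sgnz_even (h.mul_right p)]
  · simp [map_zsmul, sgnz, Int.even_mul, h, -ite_smul, -smul_ite, zs_tmul]

theorem aR_apply {p q : ℤ} {a : A.R} (ha : a ∈ A.gr p) (b : B.R) (m : X.M) {n : Y.M}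
    (hn : n ∈ Y.gm q) :
    t.aR X Y (t.Φ (a ⊗ₜ b)) (m ⊗ₜ n) = sgnz (p * q) • (X.actR a m ⊗ₜ Y.actR b n) := by
  simp only [aR, LinearMap.comp_apply, LinearEquiv.coe_coe, LinearEquiv.symm_apply_apply,
    TensorProduct.lift.tmul, LinearMap.add_apply, LinearMap.compl₂_apply,
    TensorProduct.mapBilinear_apply, TensorProduct.map_tmul, sg_apply Y.gm hn,
    pe_apply A.gr ha, po_apply A.gr ha]
  split_ifs with h
  · simp [sgnz_even (h.mul_right q)]
  · simp [map_zsmul, sgnz, Int.even_mul, h, -ite_smul, -smul_ite, tmul_zs]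

theorem aL_deg (i j : ℤ) (x : C.R) (m : X.M ⊗[k] Y.M) (hx : x ∈ C.gr i)
    (hm : m ∈ tenGrade X.gm Y.gm j) : t.aL X Y x m ∈ tenGrade X.gm Y.gm (i + j) := by
  refine t.gr_ind (p := fun x => t.aL X Y x m ∈ tenGrade X.gm Y.gm (i + j)) ?_
    (fun x y hx hy => by rw [map_add]; exact Submodule.add_mem _ hx hy) x hx
  intro i' j' hij a ha b hb
  refine tengr_ind X.gm Y.gm (p := fun m => t.aL X Y _ m ∈ tenGrade X.gm Y.gm (i + j)) ?_
    (fun x y hx hy => by rw [map_add]; exact Submodule.add_mem _ hx hy) hm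
  intro p q hpq m hm n hn
  rw [t.aL_apply X Y a hb hm]
  exact zsmul_mem (mem_ten (X.actL_deg _ _ _ _ ha hm) (Y.actL_deg _ _ _ _ hb hn) (by omega)) _

theorem aR_deg (i j : ℤ) (x : C.R) (m : X.M ⊗[k] Y.M) (hx : x ∈ C.gr i)
    (hm : m ∈ tenGrade X.gm Y.gm j) : t.aR X Y x m ∈ tenGrade X.gm Y.gm (j + i) := by
  refine t.gr_ind (p := fun x => t.aR X Y x m ∈ tenGrade X.gm Y.gm (j + i)) ?_
    (fun x y hx hy => by rw [map_add]; exact Submodule.add_mem _ hx hy) x hx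
  intro i' j' hij a ha b hb
  refine tengr_ind X.gm Y.gm (p := fun m => t.aR X Y _ m ∈ tenGrade X.gm Y.gm (j + i)) ?_
    (fun x y hx hy => by rw [map_add]; exact Submodule.add_mem _ hx hy) hm
  intro p q hpq m hm n hn
  rw [t.aR_apply X Y ha b m hn]
  exact zsmul_mem (mem_ten (X.actR_deg _ _ _ _ ha hm) (Y.actR_deg _ _ _ _ hb hn) (by omega)) _

theorem aL_mul (x y : C.R) (m : X.M ⊗[k] Y.M) :
    t.aL X Y (x * y) m = t.aL X Y x (t.aL X Y y m) := by
  revert x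
  refine t.ind ?_ (fun x y hx hy => by simp only [add_mul, map_add, LinearMap.add_apply, hx, hy])
  intro i j a ha b hb
  revert y
  refine t.ind ?_ (fun x y hx hy => by simp only [mul_add, map_add, LinearMap.add_apply, hx, hy])
  intro i' j' a' ha' b' hb'
  revert m
  refine ten_ind X.gm Y.gm (fun p q m hm n hn => ?_) (fun x y hx hy => by simp only [map_add, hx, hy])
  rw [t.mulΦ a b' hb ha', map_zsmul, LinearMap.smul_apply,
    t.aL_apply X Y (a * a') (B.mul_mem hb hb') hm,
    t.aL_apply X Y a' hb' hm, map_zsmul, t.aL_apply X Y a hb (X.actL_deg _ _ _ _ ha' hm),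
    X.actL_mul, Y.actL_mul, smul_smul, smul_smul]
  congr 1
  simp only [sgnz, Int.even_add, Int.even_mul, Int.even_sub, Int.not_even_one]; grind

theorem aR_mul (x y : C.R) (m : X.M ⊗[k] Y.M) :
    t.aR X Y (x * y) m = t.aR X Y y (t.aR X Y x m) := by
  revert x
  refine t.ind ?_ (fun x y hx hy => by simp only [add_mul, map_add, LinearMap.add_apply, hx, hy])
  intro i j a ha b hb
  revert y
  refine t.ind ?_ (fun x y hx hy => by simp only [mul_add, map_add, LinearMap.add_apply, hx, hy])
  intro i' j' a' ha' b' hb'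
  revert m
  refine ten_ind X.gm Y.gm (fun p q m hm n hn => ?_) (fun x y hx hy => by simp only [map_add, hx, hy])
  rw [t.mulΦ a b' hb ha', map_zsmul, LinearMap.smul_apply,
    t.aR_apply X Y (A.mul_mem ha ha') (b * b') m hn,
    t.aR_apply X Y ha b m hn, map_zsmul, t.aR_apply X Y ha' b' _ (Y.actR_deg _ _ _ _ hb hn),
    X.actR_mul, Y.actR_mul, smul_smul, smul_smul]
  congr 1
  simp only [sgnz, Int.even_add, Int.even_mul, Int.even_sub, Int.not_even_one]; grind

theorem aLR (x y : C.R) (m : X.M ⊗[k] Y.M) :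
    t.aL X Y x (t.aR X Y y m) = t.aR X Y y (t.aL X Y x m) := by
  revert x
  refine t.ind ?_ (fun x y hx hy => by simp only [map_add, LinearMap.add_apply, hx, hy])
  intro i j a ha b hb
  revert y
  refine t.ind ?_ (fun x y hx hy => by simp only [map_add, LinearMap.add_apply, hx, hy])
  intro i' j' a' ha' b' hb'
  revert m
  refine ten_ind X.gm Y.gm (fun p q m hm n hn => ?_) (fun x y hx hy => by simp only [map_add, hx, hy])
  rw [t.aR_apply X Y ha' b' m hn, t.aL_apply X Y a hb hm, map_zsmul, map_zsmul,
    t.aL_apply X Y a hb (X.actR_deg _ _ _ _ ha' hm),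
    t.aR_apply X Y ha' b' _ (Y.actL_deg _ _ _ _ hb hn),
    X.actLR, Y.actLR, smul_smul, smul_smul]
  congr 1
  simp only [sgnz, Int.even_add, Int.even_mul, Int.even_sub, Int.not_even_one]; grind

theorem leibL (i : ℤ) (x : C.R) (hx : x ∈ C.gr i) (m : X.M ⊗[k] Y.M) :
    tD X.gm X.D Y.D (t.aL X Y x m) = t.aL X Y (C.d x) m +
      sgnz i • t.aL X Y x (tD X.gm X.D Y.D m) := by
  refine t.gr_ind (p := fun x => tD X.gm X.D Y.D (t.aL X Y x m) = t.aL X Y (C.d x) m +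
      sgnz i • t.aL X Y x (tD X.gm X.D Y.D m)) ?_
    (fun x y hx hy => by
      simp only [map_add, LinearMap.add_apply, hx, hy, smul_add]; abel) x hx
  rintro i j rfl a ha b hb
  revert m
  refine ten_ind X.gm Y.gm (fun p q m hm n hn => ?_)
    (fun x y hx hy => by simp only [map_add, hx, hy, smul_add]; abel)
  rw [t.aL_apply X Y a hb hm, map_zsmul, tD_apply X.gm _ _ (X.actL_deg _ _ _ _ ha hm),
    X.leibnizL i p a m ha hm, Y.leibnizL j q b n hb hn, t.dΦ b ha, map_add, map_zsmul,
    LinearMap.add_apply, LinearMap.smul_apply, t.aL_apply X Y _ hb hm,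
    t.aL_apply X Y _ (B.d_deg _ _ hb) hm, tD_apply X.gm _ _ hm, map_add, map_zsmul,
    t.aL_apply X Y _ hb hm, t.aL_apply X Y _ hb (X.D_deg _ _ hm), TensorProduct.add_tmul,
    TensorProduct.tmul_add, zs_tmul, tmul_zs]
  match_scalars <;> simp only [sgnz, Int.even_add, Int.even_mul, Int.even_sub, Int.not_even_one] <;> grind

theorem leibR (i j : ℤ) (x : C.R) (m : X.M ⊗[k] Y.M) (hx : x ∈ C.gr i)
    (hm : m ∈ tenGrade X.gm Y.gm j) :
    tD X.gm X.D Y.D (t.aR X Y x m) = t.aR X Y x (tD X.gm X.D Y.D m) +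
      sgnz j • t.aR X Y (C.d x) m := by
  refine t.gr_ind (p := fun x => tD X.gm X.D Y.D (t.aR X Y x m) =
      t.aR X Y x (tD X.gm X.D Y.D m) + sgnz j • t.aR X Y (C.d x) m) ?_
    (fun x y hx hy => by
      simp only [map_add, LinearMap.add_apply, hx, hy, smul_add]; abel) x hx
  rintro i i' rfl a ha b hb
  refine tengr_ind X.gm Y.gm (p := fun m => tD X.gm X.D Y.D (t.aR X Y _ m) =
      t.aR X Y _ (tD X.gm X.D Y.D m) + sgnz j • t.aR X Y _ m) ?_
    (fun x y hx hy => by simp only [map_add, hx, hy, smul_add]; abel) hm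
  rintro p q rfl m hm n hn
  rw [t.aR_apply X Y ha b m hn, map_zsmul, tD_apply X.gm _ _ (X.actR_deg _ _ _ _ ha hm),
    X.leibnizR i p a m ha hm, Y.leibnizR i' q b n hb hn, t.dΦ b ha, map_add, map_zsmul,
    LinearMap.add_apply, LinearMap.smul_apply, t.aR_apply X Y (A.d_deg _ _ ha) _ _ hn,
    t.aR_apply X Y ha _ _ hn, tD_apply X.gm _ _ hm, map_add, map_zsmul,
    t.aR_apply X Y ha _ _ hn, t.aR_apply X Y ha _ _ (Y.D_deg _ _ hn), TensorProduct.add_tmul,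
    TensorProduct.tmul_add, zs_tmul, tmul_zs]
  match_scalars <;> simp only [sgnz, Int.even_add, Int.even_mul, Int.even_sub, Int.not_even_one] <;> grind

def tB : DGBimod C where
  M := X.M ⊗[k] Y.M
  gm := tenGrade X.gm Y.gm
  actL := t.aL X Y
  actR := t.aR X Y
  actL_one := by
    refine ten_ind X.gm Y.gm (fun p q m hm n hn => ?_) (fun x y hx hy => by simp only [map_add, hx, hy])
    rw [← t.oneΦ, t.aL_apply X Y 1 B.one_mem hm, X.actL_one, Y.actL_one]; simp [sgnz]
  actR_one := by
    refine ten_ind X.gm Y.gm (fun p q m hm n hn => ?_) (fun x y hx hy => by simp only [map_add, hx, hy])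
    rw [← t.oneΦ, t.aR_apply X Y A.one_mem 1 m hn, X.actR_one, Y.actR_one]; simp [sgnz]
  actL_mul := t.aL_mul X Y
  actR_mul := t.aR_mul X Y
  actLR := t.aLR X Y
  actL_deg := t.aL_deg X Y
  actR_deg := t.aR_deg X Y
  D := tD X.gm X.D Y.D
  D_deg := tD_deg X.gm Y.gm X.D_deg Y.D_deg
  D_sq := tD_sq X.gm X.D_sq Y.D_sq X.D_deg
  leibnizL := fun i j x m hx hm => t.leibL X Y i x hx m
  leibnizR := fun i j x m hx hm => t.leibR X Y i j x m hx hm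

end TD


namespace TD
variable {A B C : DGAlgebra k} (t : TD A B C)

theorem lin {X X' : DGBimod A} {Y Y' : DGBimod B} (a b : ℤ) (F : X.M →ₗ[k] X'.M)
    (G : Y.M →ₗ[k] Y'.M) (K : X.M ⊗[k] Y.M →ₗ[k] X'.M ⊗[k] Y'.M)
    (hK : ∀ j, ∀ m ∈ X.gm j, ∀ n, K (m ⊗ₜ n) = sgnz (b * j) • (F m ⊗ₜ G n))
    (Fd : ∀ j, ∀ m ∈ X.gm j, F m ∈ X'.gm (j + a))
    (Gd : ∀ j, ∀ m ∈ Y.gm j, G m ∈ Y'.gm (j + b))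
    (FL1 : ∀ (i : ℤ) (x : A.R), x ∈ A.gr i → ∀ m, F (X.actL x m) = sgnz (i * a) • X'.actL x (F m))
    (GL1 : ∀ (i : ℤ) (x : B.R), x ∈ B.gr i → ∀ m, G (Y.actL x m) = sgnz (i * b) • Y'.actL x (G m))
    (FR : ∀ x m, F (X.actR x m) = X'.actR x (F m))
    (GR : ∀ x m, G (Y.actR x m) = Y'.actR x (G m)) :
    (∀ (i : ℤ) (x : C.R), x ∈ C.gr i → ∀ m, K (t.aL X Y x m) =
      sgnz (i * (a + b)) • t.aL X' Y' x (K m)) ∧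
    (∀ (x : C.R) (m), K (t.aR X Y x m) = t.aR X' Y' x (K m)) := by
  constructor
  · intro i x hx m
    refine t.gr_ind (p := fun x => K (t.aL X Y x m) =
      sgnz (i * (a + b)) • t.aL X' Y' x (K m)) ?_
      (fun x y hx hy => by simp only [map_add, LinearMap.add_apply, hx, hy, smul_add]) x hx
    rintro i j rfl x hx y hy
    revert m
    refine ten_ind X.gm Y.gm (fun p q m hm n hn => ?_)
      (fun x y hx hy => by simp only [map_add, hx, hy, smul_add])
    rw [t.aL_apply X Y x hy hm, map_zsmul, hK _ _ (X.actL_deg _ _ _ _ hx hm), hK _ _ hm,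
      FL1 i x hx, GL1 j y hy, map_zsmul, t.aL_apply X' Y' x hy (Fd _ _ hm), zs_tmul, tmul_zs]
    simp only [smul_smul]
    congr 1
    simp only [sgnz, Int.even_add, Int.even_mul, Int.even_sub, Int.not_even_one]; grind
  · intro x m
    revert x
    refine t.ind ?_ (fun x y hx hy => by simp only [map_add, LinearMap.add_apply, hx, hy])
    intro i j x hx y hy
    revert m
    refine ten_ind X.gm Y.gm (fun p q m hm n hn => ?_)
      (fun x y hx hy => by simp only [map_add, hx, hy, smul_add])
    rw [t.aR_apply X Y hx y m hn, map_zsmul, hK _ _ (X.actR_deg _ _ _ _ hx hm), hK _ _ hm,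
      FR, GR, map_zsmul, t.aR_apply X' Y' hx y _ (Gd _ _ hn)]
    simp only [smul_smul]
    congr 1
    simp only [sgnz, Int.even_add, Int.even_mul, Int.even_sub, Int.not_even_one]; grind

theorem hom0 {X X' : DGBimod A} (F : BimodHom X X') :
    (∀ j, ∀ m ∈ X.gm j, F.f m ∈ X'.gm (j + 0)) ∧
    (∀ (i : ℤ) (x : A.R), x ∈ A.gr i → ∀ m, F.f (X.actL x m) = sgnz (i * 0) • X'.actL x (F.f m)) :=
  ⟨by simpa using F.deg, by intro i x hx m; rw [F.actLc]; simp [sgnz]⟩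

theorem ho1 {X X' : DGBimod A} {h : X.M →ₗ[k] X'.M}
    (hh : ∀ (i : ℤ) (x : A.R), x ∈ A.gr i → ∀ m, h (X.actL x m) = sgnz i • X'.actL x (h m)) :
    (∀ (i : ℤ) (x : A.R), x ∈ A.gr i → ∀ m, h (X.actL x m) = sgnz (i * (-1)) • X'.actL x (h m)) := by
  intro i x hx m
  rw [hh i x hx m]; simp [sgnz]

def tHom {X X' : DGBimod A} {Y Y' : DGBimod B} (F : BimodHom X X') (G : BimodHom Y Y') :
    BimodHom (t.tB X Y) (t.tB X' Y') where
  f := TensorProduct.map F.f G.f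
  deg := fun j m hm => by
    have := map_deg X.gm Y.gm X'.gm Y'.gm 0 0 (hom0 F).1 (hom0 G).1 j m hm
    rw [add_zero, add_zero] at this
    exact this
  comm := map_tD X.gm X'.gm F.deg F.comm G.comm
  actLc := fun x m => by
    refine lin_of_hom (B := C) (p := fun x => TensorProduct.map F.f G.f (t.aL X Y x m))
      (q := fun x => t.aL X' Y' x (TensorProduct.map F.f G.f m))
      (by intro x y; simp only [map_add, LinearMap.add_apply]; exact map_add _ _ _)
      (by intro x y; simp only [map_add, LinearMap.add_apply]) (fun i x hx => ?_) x
    exact (t.lin 0 0 F.f G.f (TensorProduct.map F.f G.f) (by intro j m hm n; simp [sgnz])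
      (hom0 F).1 (hom0 G).1 (hom0 F).2 (hom0 G).2 F.actRc G.actRc).1 i x hx m
  actRc := (t.lin 0 0 F.f G.f (TensorProduct.map F.f G.f) (by intro j m hm n; simp [sgnz])
      (hom0 F).1 (hom0 G).1 (hom0 F).2 (hom0 G).2 F.actRc G.actRc).2

theorem hosummand {P T : DGBimod A} {Q U : DGBimod B} (h1 : IsHoSummandB P T)
    (h2 : IsHoSummandB Q U) : IsHoSummandB (t.tB P Q) (t.tB T U) := by
  obtain ⟨ι, ρ, hA, a1, a2, a3, a4⟩ := h1
  obtain ⟨ι', ρ', hB, b1, b2, b3, b4⟩ := h2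
  refine ⟨t.tHom ι ι', t.tHom ρ ρ', ?_⟩
  let G := (ρ'.comp ι')
  let I := BimodHom.id P
  have l1 := t.lin (X := P) (X' := P) (Y := Q) (Y' := Q) (-1) 0 hA G.f
    (TensorProduct.map hA G.f) (by intro j m hm n; simp [sgnz]) a1 (hom0 G).1
    (ho1 a2) (hom0 G).2 a3 G.actRc
  have l2 := t.lin (X := P) (X' := P) (Y := Q) (Y' := Q) 0 (-1) I.f hB
    (TensorProduct.map (I.f ∘ₗ sg P.gm) hB)
    (by intro j m hm n; simp [sg_apply P.gm hm, map_zsmul, zs_tmul, sgnz, -ite_smul]) (hom0 I).1 b1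
    (hom0 I).2 (ho1 b2) I.actRc b3
  refine ⟨tenHt P.gm hA G.f I.f hB, ?_, ?_, ?_, ?_⟩
  · exact tenHt_deg P.gm Q.gm P.gm Q.gm a1 G.deg I.deg b1
  · intro i x hx m
    have e1 := l1.1 i x hx m
    have e2 := l2.1 i x hx m
    have s : sgnz (i * (-1 + 0)) = sgnz i := by simp [sgnz]
    have s' : sgnz (i * (0 + -1)) = sgnz i := by simp [sgnz]
    rw [s] at e1; rw [s'] at e2
    refine (congrArg₂ (· + ·) e1 e2).trans ?_
    refine (smul_add (sgnz i) (t.aL P Q x _) (t.aL P Q x _)).symm.trans ?_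
    exact congrArg (fun z => sgnz i • z) (map_add (t.aL P Q x) _ _).symm
  · intro x m
    refine (congrArg₂ (· + ·) (l1.2 x m) (l2.2 x m)).trans ?_
    exact (map_add (t.aR P Q x) _ _).symm
  · intro m
    have := tenHt_spec P.gm P.gm (D₁ := P.D) (D₁' := P.D) (D₂ := Q.D) (D₂' := Q.D)
      (F := (ρ.comp ι).f) (F' := I.f) (G := G.f) (G' := LinearMap.id) (hA := hA) (hB := hB)
      P.D_deg a1 I.deg I.comm G.comm a4 b4 m
    refine Eq.trans ?_ this
    have e1 : TensorProduct.map (ρ.comp ι).f G.f =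
      TensorProduct.map ρ.f ρ'.f ∘ₗ TensorProduct.map ι.f ι'.f := TensorProduct.map_comp _ _ _ _
    have e2 : TensorProduct.map I.f (LinearMap.id : Q.M →ₗ[k] Q.M) = LinearMap.id :=
      TensorProduct.map_id
    rw [e1, e2]; rfl

theorem diag {P : DGBimod A} {Q : DGBimod B} (F : BimodHom P (diagBimod A))
    (G : BimodHom Q (diagBimod B)) (hF : QIsoData P.gm P.D A.gr A.d F.f)
    (hG : QIsoData Q.gm Q.D B.gr B.d G.f) :
    ∃ H : BimodHom (t.tB P Q) (diagBimod C), QIsoData (t.tB P Q).gm (t.tB P Q).D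
      (diagBimod C).gm (diagBimod C).D H.f := by
  let E : BimodHom (t.tB (diagBimod A) (diagBimod B)) (diagBimod C) :=
    { f := t.Φ.toLinearMap
      deg := t.degΦ
      comm := by
        change ∀ x : A.R ⊗[k] B.R, t.Φ (tD A.gr A.d B.d x) = C.d (t.Φ x)
        refine ten_ind A.gr B.gr (fun p q m hm n hn => ?_)
          (fun x y hx hy => by simp only [map_add, hx, hy])
        rw [tD_apply A.gr _ _ hm, map_add, map_zsmul, t.dΦ n hm]
      actLc := by
        change ∀ (c : C.R) (x : A.R ⊗[k] B.R),
          t.Φ (t.aL (diagBimod A) (diagBimod B) c x) = c * t.Φ x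
        intro c x
        revert c
        refine t.ind ?_ (fun x y hx hy => by
          rw [map_add, add_mul, ← hx, ← hy]; exact map_add t.Φ _ _)
        intro i j a ha b hb
        revert x
        refine ten_ind A.gr B.gr (fun p q m hm n hn => ?_)
          (fun x y hx hy => by
            rw [map_add t.Φ, mul_add, ← hx, ← hy]
            exact (congrArg t.Φ (map_add _ _ _)).trans (map_add t.Φ _ _))
        refine (congrArg t.Φ (t.aL_apply (diagBimod A) (diagBimod B) a hb hm n)).trans ?_
        rw [t.mulΦ a n hb hm]
        exact map_zsmul t.Φ (sgnz (j * p)) ((a * m) ⊗ₜ (b * n))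
      actRc := by
        change ∀ (c : C.R) (x : A.R ⊗[k] B.R),
          t.Φ (t.aR (diagBimod A) (diagBimod B) c x) = t.Φ x * c
        intro c x
        revert c
        refine t.ind ?_ (fun x y hx hy => by
          rw [map_add, mul_add, ← hx, ← hy]; exact map_add t.Φ _ _)
        intro i j a ha b hb
        revert x
        refine ten_ind A.gr B.gr (fun p q m hm n hn => ?_)
          (fun x y hx hy => by
            rw [map_add t.Φ, add_mul, ← hx, ← hy]
            exact (congrArg t.Φ (map_add _ _ _)).trans (map_add t.Φ _ _))
        refine (congrArg t.Φ (t.aR_apply (diagBimod A) (diagBimod B) ha b m hn)).trans ?_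
        rw [t.mulΦ m b hn ha, mul_comm i q]
        exact map_zsmul t.Φ (sgnz (q * i)) ((m * a) ⊗ₜ (n * b)) }
  refine ⟨E.comp (t.tHom F G), ?_⟩
  have q := kunneth P.gm Q.gm A.gr B.gr P.D_sq Q.D_sq A.d_sq B.d_sq P.D_deg Q.D_deg A.d_deg B.d_deg
    (F := F.f) (G := G.f) F.deg G.deg F.comm G.comm hF hG
  exact qiso_comp_equiv (gx := C.gr) q t.Φ t.degΦ
    (fun j x hx => equiv_gr (gm := tenGrade A.gr B.gr) (gn := C.gr) t.Φ t.degΦ j x hx) E.comm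

end TD


theorem bij_iff {ι V W : Type} [Fintype ι] [DecidableEq ι] [AddCommGroup V] [Module k V]
    [AddCommGroup W] [Module k W] (l : ι → V →ₗ[k] W) :
    Function.Bijective (fun v : ι → V => ∑ j, l j (v j)) ↔
      ∃ κ : ι → W →ₗ[k] V, (∀ i j, κ i ∘ₗ l j = if i = j then LinearMap.id else 0) ∧
        ∀ w, ∑ j, l j (κ j w) = w := by
  constructor
  · intro h
    let f : (ι → V) →ₗ[k] W := ∑ j, l j ∘ₗ LinearMap.proj j
    have hf : ∀ v, f v = ∑ j, l j (v j) := by intro v; simp [f]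
    have hb : Function.Bijective f := by
      rw [show (f : (ι → V) → W) = _ from funext hf]; exact h
    let e := LinearEquiv.ofBijective f hb
    refine ⟨fun i => LinearMap.proj i ∘ₗ e.symm.toLinearMap, fun i j => ?_, fun w => ?_⟩
    · refine LinearMap.ext fun v => ?_
      have : e (Pi.single j v) = l j v := by
        change f _ = _
        rw [hf, Finset.sum_eq_single j]
        · simp
        · intro b _ hb; simp [hb]
        · simp
      simp only [LinearMap.comp_apply, LinearEquiv.coe_coe, ← this, LinearEquiv.symm_apply_apply,
        LinearMap.proj_apply]
      by_cases hij : i = j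
      · subst hij; simp
      · simp [hij]
    · have := e.apply_symm_apply w
      rw [← hf]; exact this
  · rintro ⟨κ, h1, h2⟩
    have h1' : ∀ i j v, κ i (l j v) = if i = j then v else 0 := by
      intro i j v
      have := LinearMap.congr_fun (h1 i j) v
      rw [LinearMap.comp_apply] at this
      rw [this]; split_ifs <;> simp
    refine Function.bijective_iff_has_inverse.2 ⟨fun w j => κ j w, fun v => ?_, h2⟩
    funext i
    simp [map_sum, h1']

theorem ten4_ind {M N M' N' : Type} [AddCommGroup M] [Module k M] [AddCommGroup N] [Module k N]
    [AddCommGroup M'] [Module k M'] [AddCommGroup N'] [Module k N']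
    (gm : ℤ → Submodule k M) [DirectSum.Decomposition gm]
    (gn : ℤ → Submodule k N) [DirectSum.Decomposition gn]
    (gm' : ℤ → Submodule k M') [DirectSum.Decomposition gm']
    (gn' : ℤ → Submodule k N') [DirectSum.Decomposition gn']
    {p : (M ⊗[k] N) ⊗[k] (M' ⊗[k] N') → Prop}
    (h : ∀ i j i' j', ∀ a ∈ gm i, ∀ b ∈ gn j, ∀ a' ∈ gm' i', ∀ b' ∈ gn' j',
      p ((a ⊗ₜ b) ⊗ₜ (a' ⊗ₜ b'))) (ha : ∀ x y, p x → p y → p (x + y)) (z) : p z := by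
  induction z with
  | zero =>
    have := h 0 0 0 0 0 (zero_mem _) 0 (zero_mem _) 0 (zero_mem _) 0 (zero_mem _)
    simpa using this
  | add x y hx hy => exact ha _ _ hx hy
  | tmul x y =>
    revert x
    refine ten_ind gm gn ?_ (fun x x' hx hx' => by rw [TensorProduct.add_tmul]; exact ha _ _ hx hx')
    intro i j a hma b hb
    revert y
    refine ten_ind gm' gn' ?_ (fun x x' hx hx' => by rw [TensorProduct.tmul_add]; exact ha _ _ hx hx')
    intro i' j' a' ha' b' hb'
    exact h i j i' j' a hma b hb a' ha' b' hb'

namespace TD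
variable {A B C : DGAlgebra k} (t : TD A B C)

/-- sign operator -/
def sq (A B : DGAlgebra k) (q : ℤ) : (A.R ⊗[k] B.R) ⊗[k] (A.R ⊗[k] B.R) →ₗ[k]
    (A.R ⊗[k] B.R) ⊗[k] (A.R ⊗[k] B.R) :=
  (TensorProduct.map (TensorProduct.map LinearMap.id (pe B.gr)) LinearMap.id +
    TensorProduct.map (TensorProduct.map LinearMap.id (po B.gr))
      (TensorProduct.map (sg A.gr) LinearMap.id)) ∘ₗ
  TensorProduct.map (TensorProduct.map (gop A.gr (fun i => sgnk k (i * q))) LinearMap.id)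
    (TensorProduct.map (gop A.gr (fun i => sgnk k (i * q))) LinearMap.id)

theorem sq_apply (q : ℤ) {i j i' : ℤ} {a a' : A.R} {b b' : B.R} (ha : a ∈ A.gr i)
    (hb : b ∈ B.gr j) (ha' : a' ∈ A.gr i') :
    sq A B q ((a ⊗ₜ b) ⊗ₜ (a' ⊗ₜ b')) =
      sgnz (i * q + i' * q + j * i') • ((a ⊗ₜ b) ⊗ₜ (a' ⊗ₜ b')) := by
  simp only [sq, LinearMap.comp_apply, TensorProduct.map_tmul, gop_apply A.gr _ ha,
    gop_apply A.gr _ ha', sgnk_smul, LinearMap.id_apply, zs_tmul, tmul_zs, map_zsmul,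
    LinearMap.add_apply, pe_apply B.gr hb, po_apply B.gr hb, sg_apply A.gr ha', smul_smul]
  rw [sgnz_add, sgnz_add, mul_comm (sgnz (i * q))]
  split_ifs with h
  · simp [sgnz_even (h.mul_right i'), smul_smul]
  · have : sgnz (j * i') = sgnz i' := by simp [sgnz, Int.even_mul, h]
    simp [this, smul_smul, mul_assoc]

theorem sq_sq (q : ℤ) (z) : sq A B q (sq A B q z) = z := by
  refine ten4_ind A.gr B.gr A.gr B.gr (p := fun z => sq A B q (sq A B q z) = z) ?_
    (fun x y hx hy => by rw [map_add, map_add, hx, hy]) z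
  intro i j i' j' a ha b hb a' ha' b' hb'
  rw [sq_apply q ha hb ha', map_zsmul, sq_apply q ha hb ha', sgnz_smul_smul]

def W (q : ℤ) : (C.R ⊗[k] C.R) ≃ₗ[k] ((A.R ⊗[k] A.R) ⊗[k] (B.R ⊗[k] B.R)) :=
  ((TensorProduct.congr t.Φ.symm t.Φ.symm) ≪≫ₗ
    (LinearEquiv.ofLinear (sq A B q) (sq A B q)
      (LinearMap.ext (sq_sq q)) (LinearMap.ext (sq_sq q)))) ≪≫ₗ
    TensorProduct.tensorTensorTensorComm k A.R B.R A.R B.R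

theorem biact_ten {T : DGBimod A} {U : DGBimod B} {p q : ℤ} {e : T.M} {f : U.M}
    (he : e ∈ T.gm p) (hf : f ∈ U.gm q) (u : C.R ⊗[k] C.R) :
    biact (t.tB T U) u (e ⊗ₜ[k] f : T.M ⊗[k] U.M) =
      TensorProduct.map ((biact T).flip e) ((biact U).flip f) (t.W q u) := by
  obtain ⟨v, rfl⟩ := (TensorProduct.congr t.Φ t.Φ).surjective u
  refine ten4_ind A.gr B.gr A.gr B.gr (p := fun v =>
    biact (t.tB T U) (TensorProduct.congr t.Φ t.Φ v) (e ⊗ₜ[k] f : T.M ⊗[k] U.M) =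
      TensorProduct.map ((biact T).flip e) ((biact U).flip f)
        (t.W q (TensorProduct.congr t.Φ t.Φ v))) ?_
    (fun x y hx hy => by
      simp only [map_add, LinearMap.add_apply]
      exact congrArg₂ (· + ·) hx hy) v
  intro i j i' j' a ha b hb a' ha' b' hb'
  rw [TensorProduct.congr_tmul]
  have e1 : t.W q (t.Φ (a ⊗ₜ b) ⊗ₜ t.Φ (a' ⊗ₜ b')) =
      sgnz (i * q + i' * q + j * i') • ((a ⊗ₜ a') ⊗ₜ (b ⊗ₜ b')) := by
    simp only [W, LinearEquiv.trans_apply, TensorProduct.congr_tmul,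
      LinearEquiv.symm_apply_apply, LinearEquiv.ofLinear_apply, sq_apply q ha hb ha',
      map_zsmul, TensorProduct.tensorTensorTensorComm_tmul]
  rw [e1]
  refine (biact_apply (t.tB T U) (t.degΦ' ha hb rfl) (mem_ten he hf rfl)).trans ?_
  change sgnz ((i + j) * (p + q)) • t.aL T U (t.Φ (a ⊗ₜ b)) (t.aR T U (t.Φ (a' ⊗ₜ b')) (e ⊗ₜ f)) = _
  rw [t.aR_apply T U ha' b' e hf, map_zsmul, t.aL_apply T U a hb (T.actR_deg _ _ _ _ ha' he),
    map_zsmul, TensorProduct.map_tmul, LinearMap.flip_apply, LinearMap.flip_apply,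
    biact_apply T ha he, biact_apply U hb hf, zs_tmul, tmul_zs]
  simp only [smul_smul]
  congr 1
  simp only [sgnz, Int.even_add, Int.even_mul, Int.even_sub, Int.not_even_one]; grind

theorem span_left {T : DGBimod A} {U : DGBimod B} {q : ℤ} {f : U.M} (hf : f ∈ U.gm q)
    {S : Set T.M} (p : Submodule k (T.M ⊗[k] U.M)) (hS : ∀ m ∈ S, m ⊗ₜ[k] f ∈ p)
    (hL : ∀ (x : C.R) (m : T.M ⊗[k] U.M), m ∈ p → t.aL T U x m ∈ p)
    (hR : ∀ (x : C.R) (m : T.M ⊗[k] U.M), m ∈ p → t.aR T U x m ∈ p)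
    {m : T.M} (hm : m ∈ biSpan T S) : m ⊗ₜ[k] f ∈ p := by
  let P : Submodule k T.M := p.comap ((TensorProduct.mk k T.M U.M).flip f)
  have : biSpan T S ≤ P := by
    refine sInf_le ⟨hS, ?_, ?_⟩
    · intro a m hm
      have h := hL (t.Φ (a ⊗ₜ 1)) (m ⊗ₜ f) hm
      have h2 : t.aL T U (t.Φ (a ⊗ₜ 1)) (m ⊗ₜ f) = T.actL a m ⊗ₜ f := by
        refine hom_ind T.gm (p := fun m => t.aL T U (t.Φ (a ⊗ₜ 1)) (m ⊗ₜ f) = T.actL a m ⊗ₜ f)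
          (fun j m hm => ?_)
          (fun x y hx hy => by simp only [map_add, TensorProduct.add_tmul, hx, hy]) m
        rw [t.aL_apply T U a B.one_mem hm, U.actL_one]; simp [sgnz]
      rw [h2] at h; exact h
    · intro a m hm
      refine hom_ind A.gr (p := fun a => T.actR a m ∈ P) (fun i a ha => ?_)
        (fun x y hx hy => by rw [map_add]; exact P.add_mem hx hy) a
      have h := hR (t.Φ (a ⊗ₜ 1)) (m ⊗ₜ f) hm
      rw [t.aR_apply T U ha 1 m hf, U.actR_one] at h
      have h3 := zsmul_mem h (sgnz (i * q))
      rw [sgnz_smul_smul] at h3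
      exact h3
  exact this hm

theorem span_right {T : DGBimod A} {U : DGBimod B} {q : ℤ} {e : T.M} (he : e ∈ T.gm q)
    {S : Set U.M} (p : Submodule k (T.M ⊗[k] U.M)) (hS : ∀ m ∈ S, e ⊗ₜ[k] m ∈ p)
    (hL : ∀ (x : C.R) (m : T.M ⊗[k] U.M), m ∈ p → t.aL T U x m ∈ p)
    (hR : ∀ (x : C.R) (m : T.M ⊗[k] U.M), m ∈ p → t.aR T U x m ∈ p)
    {m : U.M} (hm : m ∈ biSpan U S) : e ⊗ₜ[k] m ∈ p := by
  let P : Submodule k U.M := p.comap (TensorProduct.mk k T.M U.M e)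
  have : biSpan U S ≤ P := by
    refine sInf_le ⟨hS, ?_, ?_⟩
    · intro b m hm
      refine hom_ind B.gr (p := fun a => U.actL a m ∈ P) (fun i b hb => ?_)
        (fun x y hx hy => by rw [map_add]; exact P.add_mem hx hy) b
      have h := hL (t.Φ (1 ⊗ₜ b)) (e ⊗ₜ m) hm
      rw [t.aL_apply T U 1 hb he, T.actL_one] at h
      have h3 := zsmul_mem h (sgnz (i * q))
      rw [sgnz_smul_smul] at h3
      exact h3
    · intro b m hm
      have h := hR (t.Φ (1 ⊗ₜ b)) (e ⊗ₜ m) hm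
      have h2 : t.aR T U (t.Φ (1 ⊗ₜ b)) (e ⊗ₜ m) = e ⊗ₜ U.actR b m := by
        refine hom_ind U.gm (p := fun m => t.aR T U (t.Φ (1 ⊗ₜ b)) (e ⊗ₜ m) = e ⊗ₜ U.actR b m)
          (fun j m hm => ?_)
          (fun x y hx hy => by simp only [map_add, TensorProduct.tmul_add, hx, hy]) m
        rw [t.aR_apply T U A.one_mem b e hm, T.actR_one]; simp [sgnz]
      rw [h2] at h; exact h
  exact this hm

theorem twisted {T : DGBimod A} {U : DGBimod B} (hT : IsTwistedB T) (hU : IsTwistedB U) :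
    IsTwistedB (t.tB T U) := by
  obtain ⟨s, r, e, h1, h2, h3⟩ := hT
  obtain ⟨s', r', f, h1', h2', h3'⟩ := hU
  let φ : Fin s × Fin s' ≃ Fin (s * s') := finProdFinEquiv
  let g : Fin (s * s') → T.M ⊗[k] U.M := fun l => e (φ.symm l).1 ⊗ₜ f (φ.symm l).2
  have hg : ∀ i j, g (φ (i, j)) = e i ⊗ₜ f j := by intro i j; simp [g]
  refine ⟨s * s', fun l => r (φ.symm l).1 + r' (φ.symm l).2, g, ?_, ?_, ?_⟩
  · intro l
    exact mem_ten (h1 _) (h1' _) (by ring)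
  · intro l
    obtain ⟨⟨i, j⟩, rfl⟩ := φ.surjective l
    have key : ∀ p : Submodule k (T.M ⊗[k] U.M), (g '' {l | l < φ (i, j)} ⊆ p) →
        (∀ (x : C.R) (m : T.M ⊗[k] U.M), m ∈ p → t.aL T U x m ∈ p) →
        (∀ (x : C.R) (m : T.M ⊗[k] U.M), m ∈ p → t.aR T U x m ∈ p) →
        tD T.gm T.D U.D (g (φ (i, j))) ∈ p := by
      intro p hp1 hp2 hp3
      rw [hg, tD_apply T.gm _ _ (h1 i)]
      refine p.add_mem ?_ (zsmul_mem ?_ _)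
      · refine t.span_left (h1' j) p ?_ hp2 hp3 (h2 i)
        rintro _ ⟨i', hi', rfl⟩
        refine hp1 ⟨φ (i', j), ?_, hg _ _⟩
        have hi : (i' : ℕ) < i := hi'
        have hj := j.2
        change φ (i', j) < φ (i, j)
        rw [Fin.lt_def]
        simp only [φ, finProdFinEquiv_apply_val]
        have : s' * (i' : ℕ) < s' * i := Nat.mul_lt_mul_of_pos_left hi (by omega)
        omega
      · refine t.span_right (h1 i) p ?_ hp2 hp3 (h2' j)
        rintro _ ⟨j', hj', rfl⟩
        refine hp1 ⟨φ (i, j'), ?_, hg _ _⟩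
        have hj : (j' : ℕ) < j := hj'
        change φ (i, j') < φ (i, j)
        rw [Fin.lt_def]
        simp only [φ, finProdFinEquiv_apply_val]
        omega
    exact Submodule.mem_sInf.2 fun p hp => key p hp.1 hp.2.1 hp.2.2
  · obtain ⟨κ, c1, c2⟩ := (bij_iff (fun i => (biact T).flip (e i))).1 h3
    obtain ⟨κ', c1', c2'⟩ := (bij_iff (fun i => (biact U).flip (f i))).1 h3'
    let l : Fin s × Fin s' → (C.R ⊗[k] C.R) →ₗ[k] (T.M ⊗[k] U.M) := fun x =>
      TensorProduct.map ((biact T).flip (e x.1)) ((biact U).flip (f x.2)) ∘ₗ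
        (t.W (-(r' x.2))).toLinearMap
    have hl : Function.Bijective (fun v : Fin s × Fin s' → C.R ⊗[k] C.R => ∑ x, l x (v x)) := by
      refine (bij_iff l).2 ⟨fun x => (t.W (-(r' x.2))).symm.toLinearMap ∘ₗ
        TensorProduct.map (κ x.1) (κ' x.2), ?_, ?_⟩
      · rintro ⟨i, j⟩ ⟨i', j'⟩
        have : TensorProduct.map (κ i) (κ' j) ∘ₗ
            TensorProduct.map ((biact T).flip (e i')) ((biact U).flip (f j')) =
            if (i, j) = (i', j') then LinearMap.id else 0 := by
          rw [← TensorProduct.map_comp, c1, c1']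
          by_cases hi : i = i'
          · by_cases hj : j = j'
            · simp [hi, hj]
            · simp [hi, hj]
          · simp [hi]
        refine LinearMap.ext fun v => ?_
        have h5 := LinearMap.congr_fun this (t.W (-(r' j')) v)
        simp only [LinearMap.comp_apply, LinearEquiv.coe_coe, l] at h5 ⊢
        rw [h5]
        by_cases hij : (i, j) = (i', j')
        · have hj : j = j' := congrArg Prod.snd hij
          rw [if_pos hij, if_pos hij, hj]; simp
        · rw [if_neg hij, if_neg hij]; simp
      · intro w
        induction w with
        | zero => simp
        | add x y hx hy => simp only [map_add, Finset.sum_add_distrib, hx, hy]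
        | tmul m n =>
          have h5 : ∀ x : Fin s × Fin s', l x (((t.W (-(r' x.2))).symm.toLinearMap ∘ₗ
              TensorProduct.map (κ x.1) (κ' x.2)) (m ⊗ₜ n)) =
              ((biact T).flip (e x.1) (κ x.1 m)) ⊗ₜ ((biact U).flip (f x.2) (κ' x.2 n)) := by
            intro x
            simp only [l, LinearMap.comp_apply, LinearEquiv.coe_coe,
              LinearEquiv.apply_symm_apply, TensorProduct.map_tmul]
          rw [Finset.sum_congr rfl (fun x _ => h5 x), Fintype.sum_prod_type]
          simp only [← TensorProduct.tmul_sum, ← TensorProduct.sum_tmul]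
          rw [c2, c2']
    have e' : (fun v : Fin (s * s') → C.R ⊗[k] C.R => ∑ j, biact (t.tB T U) (v j) (g j)) =
        (fun v : Fin s × Fin s' → C.R ⊗[k] C.R => ∑ x, l x (v x)) ∘
        (fun v : Fin (s * s') → C.R ⊗[k] C.R => v ∘ φ) := by
      funext v
      refine (Equiv.sum_comp φ (fun j => biact (t.tB T U) (v j) (g j))).symm.trans ?_
      refine Finset.sum_congr rfl (fun x _ => ?_)
      obtain ⟨i, j⟩ := x
      refine (congrArg _ (hg i j)).trans ?_
      exact t.biact_ten (h1 i) (h1' j) (v (φ (i, j)))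
    have hb : Function.Bijective (fun v : Fin (s * s') → C.R ⊗[k] C.R => v ∘ φ) :=
      (φ.arrowCongr (Equiv.refl (C.R ⊗[k] C.R))).symm.bijective
    exact e'.symm ▸ hl.comp hb

theorem smooth (t : TD A B C) (hA : IsSmooth A) (hB : IsSmooth B) : IsSmooth C := by
  obtain ⟨T, P, hT, hP, F, hF⟩ := hA
  obtain ⟨U, Q, hU, hQ, G, hG⟩ := hB
  exact ⟨t.tB T U, t.tB P Q, t.twisted hT hU, t.hosummand hP hQ, t.diag F G hF hG⟩

end TD

theorem smooth_tensor {A B C : DGAlgebra k} (hA : IsSmooth A) (hB : IsSmooth B)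
    (h : IsTensorAlgOf A B C) : IsSmooth C := by
  obtain ⟨iA, iB, a1, a2, a3, a4, a5, a6, a7, a8, a9, a10⟩ := h
  exact TD.smooth (⟨iA, iB, a1, a2, a3, a4, a5, a6, a7, a8, a9,
    LinearEquiv.ofBijective _ a10, fun x y => by simp⟩ : TD A B C) hA hB

theorem smooth_op {A A' : DGAlgebra k} (hA : IsSmooth A)
    (h : IsOppositeOf A A') : IsSmooth A' := by
  obtain ⟨φ, a1, a2, a3, a4⟩ := h
  exact op_smooth (⟨φ, a1, a2, a3, a4⟩ : OpD A A') hA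


/-- If `A` and `B` are homologically smooth DG algebras over `k`,
then `A ⊗ₖ B` is homologically smooth; in particular, if `A` is homologically smooth
then so are `Aᵒᵖ` and `Aᵉ = Aᵒᵖ ⊗ A`. -/
theorem tensor_smooth {k : Type} [Field k] (A B : DGAlgebra k) :
    (IsSmooth A → IsSmooth B → ∀ C : DGAlgebra k, IsTensorAlgOf A B C → IsSmooth C) ∧
    (IsSmooth A → ∀ A' : DGAlgebra k, IsOppositeOf A A' → IsSmooth A') ∧
    (IsSmooth A → ∀ (A' C : DGAlgebra k), IsOppositeOf A A' →
      IsTensorAlgOf A' A C → IsSmooth C) := by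
  exact ⟨fun hA hB C h => smooth_tensor hA hB h, fun hA A' h => smooth_op hA h,
    fun hA A' C h h' => smooth_tensor (smooth_op hA h) hA h'⟩
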